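/- Let f : ℚ → ℚ be given by f(x) = 3⁷(x²−1)³(x⁶+3x⁵+6x⁴+x³−3x²+12x+16)³(2x³+3x²−3x−5)/(x³−3x−1)⁹. For a rational number x, the value f(x) is an integer (i.e. lies in the image of ℤ in ℚ) if and only if x ∈ {1, −1, −2, 0, −1/2, 2, −3/2, −1/3}. -/

import Mathlib

/-- The degree-27 rational function f realizing the covering map 𝒳₉ → X(1). -/
def f (x : ℚ) : ℚ :=
  3 ^ 7 * (x ^ 2 - 1) ^ 3 *
      (x ^ 6 + 3 * x ^ 5 + 6 * x ^ 4 + x ^ 3 - 3 * x ^ 2 + 12 * x + 16) ^ 3 *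
      (2 * x ^ 3 + 3 * x ^ 2 - 3 * x - 5) / (x ^ 3 - 3 * x - 1) ^ 9

theorem prime_eq_three_of_dvd_cubic {m n : ℤ} (hmn : IsCoprime m n) {p : ℤ} (hp : Prime p)
    (hF : p ∣ m ^ 3 - 3 * m * n ^ 2 - n ^ 3)
    (hN : p ∣ 3 ^ 7 * (m ^ 2 - n ^ 2) ^ 3 *
      (m ^ 6 + 3 * m ^ 5 * n + 6 * m ^ 4 * n ^ 2 + m ^ 3 * n ^ 3 - 3 * m ^ 2 * n ^ 4
        + 12 * m * n ^ 5 + 16 * n ^ 6) ^ 3 *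
      (2 * m ^ 3 + 3 * m ^ 2 * n - 3 * m * n ^ 2 - 5 * n ^ 3)) : p ∣ 3 := by
  have key : ∀ {a b c : ℤ}, p ∣ b → a = c - b → p ∣ c → p ∣ a := fun h e h' => e ▸ dvd_sub h' h
  have hn : ¬ p ∣ n := by
    intro h
    have h3 : p ∣ m ^ 3 := by
      have := dvd_add hF (h.mul_right (3 * m * n + n ^ 2))
      ring_nf at this ⊢
      exact this
    exact hp.not_isUnit (hmn.isUnit_of_dvd' (hp.dvd_of_dvd_pow h3) h)
  have hadd : ¬ p ∣ m + n := by
    intro h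
    refine hn (hp.dvd_of_dvd_pow (n := 3) ?_)
    have := dvd_sub hF (h.mul_right (m ^ 2 - m * n - 2 * n ^ 2))
    ring_nf at this ⊢
    exact this
  have three_of_pow : ∀ k : ℕ, p ∣ 3 ^ k → p ∣ 3 := fun k h => hp.dvd_of_dvd_pow h
  rcases hp.dvd_or_dvd hN with hN | hC
  · rcases hp.dvd_or_dvd hN with hN | hS
    · rcases hp.dvd_or_dvd hN with h3 | hsq
      · exact three_of_pow _ h3
      · have hsq : p ∣ (m - n) * (m + n) := by
          have := hp.dvd_of_dvd_pow hsq
          ring_nf at this ⊢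
          exact this
        rcases hp.dvd_or_dvd hsq with h | h
        · have : p ∣ 3 * n ^ 3 := by
            have := dvd_sub (h.mul_right (m ^ 2 + m * n - 2 * n ^ 2)) hF
            ring_nf at this ⊢
            exact this
          exact (hp.dvd_or_dvd this).resolve_right fun h => hn (hp.dvd_of_dvd_pow h)
        · exact absurd h hadd
    · have hS := hp.dvd_of_dvd_pow hS
      have : p ∣ 3 ^ 3 * ((m + n) ^ 2 * n ^ 4) := by
        have := dvd_sub hS (hF.mul_right
          (m ^ 3 + 3 * m ^ 2 * n + 9 * m * n ^ 2 + 11 * n ^ 3))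
        ring_nf at this ⊢
        exact this
      rcases hp.dvd_or_dvd this with h | h
      · exact three_of_pow _ h
      · rcases hp.dvd_or_dvd h with h | h
        · exact absurd (hp.dvd_of_dvd_pow h) hadd
        · exact absurd (hp.dvd_of_dvd_pow h) hn
  · have : p ∣ 3 * (n * (m ^ 2 + m * n - n ^ 2)) := by
      have := dvd_sub hC (hF.mul_right 2)
      ring_nf at this ⊢
      exact this
    rcases hp.dvd_or_dvd this with h | h
    · exact h
    · have hq := (hp.dvd_or_dvd h).resolve_left hn
      have : p ∣ n ^ 2 * (m + 2 * n) := by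
        have := dvd_sub (hq.mul_right (m - n)) hF
        ring_nf at this ⊢
        exact this
      have h2 := (hp.dvd_or_dvd this).resolve_left fun h => hn (hp.dvd_of_dvd_pow h)
      refine absurd (hp.dvd_of_dvd_pow (n := 2) ?_) hn
      have := dvd_sub hq (h2.mul_right (m - n))
      ring_nf at this ⊢
      exact this

theorem not_nine_dvd_cubic {m n : ℤ} (hmn : IsCoprime m n) :
    ¬ 9 ∣ m ^ 3 - 3 * m * n ^ 2 - n ^ 3 := by
  intro h
  have h9 : ((m : ZMod 9)) ^ 3 - 3 * m * n ^ 2 - n ^ 3 = 0 := by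
    exact_mod_cast (ZMod.intCast_zmod_eq_zero_iff_dvd _ 9).2 h
  have key : ∀ a b : ZMod 9, a ^ 3 - 3 * a * b ^ 2 - b ^ 3 = 0 → 3 * a = 0 ∧ 3 * b = 0 := by decide
  have three : ∀ a : ℤ, 3 * (a : ZMod 9) = 0 → 3 ∣ a := by
    intro a ha
    have : (9 : ℤ) ∣ 3 * a := (ZMod.intCast_zmod_eq_zero_iff_dvd _ 9).1 (by exact_mod_cast ha)
    omega
  obtain ⟨ha, hb⟩ := key _ _ h9
  exact Int.prime_three.not_isUnit (hmn.isUnit_of_dvd' (three _ ha) (three _ hb))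

theorem natAbs_cubic_eq_one_or_three {m n : ℤ} (hmn : IsCoprime m n)
    (hF0 : m ^ 3 - 3 * m * n ^ 2 - n ^ 3 ≠ 0)
    (h : m ^ 3 - 3 * m * n ^ 2 - n ^ 3 ∣ 3 ^ 7 * (m ^ 2 - n ^ 2) ^ 3 *
      (m ^ 6 + 3 * m ^ 5 * n + 6 * m ^ 4 * n ^ 2 + m ^ 3 * n ^ 3 - 3 * m ^ 2 * n ^ 4
        + 12 * m * n ^ 5 + 16 * n ^ 6) ^ 3 *
      (2 * m ^ 3 + 3 * m ^ 2 * n - 3 * m * n ^ 2 - 5 * n ^ 3)) :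
    (m ^ 3 - 3 * m * n ^ 2 - n ^ 3).natAbs = 1 ∨ (m ^ 3 - 3 * m * n ^ 2 - n ^ 3).natAbs = 3 := by
  have hpow : (m ^ 3 - 3 * m * n ^ 2 - n ^ 3).natAbs =
      3 ^ (m ^ 3 - 3 * m * n ^ 2 - n ^ 3).natAbs.primeFactorsList.length := by
    refine Nat.eq_prime_pow_of_unique_prime_dvd (Int.natAbs_ne_zero.2 hF0) fun {d} hd hdvd => ?_
    have hdF := Int.natCast_dvd.2 hdvd
    have h3 := prime_eq_three_of_dvd_cubic hmn (Nat.prime_iff_prime_int.1 hd) hdF (hdF.trans h)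
    exact (Nat.prime_dvd_prime_iff_eq hd Nat.prime_three).1 (by exact_mod_cast h3)
  generalize (m ^ 3 - 3 * m * n ^ 2 - n ^ 3).natAbs.primeFactorsList.length = k at hpow
  match k, hpow with
  | 0, hpow => exact Or.inl hpow
  | 1, hpow => exact Or.inr hpow
  | k + 2, hpow =>
    refine absurd ?_ (not_nine_dvd_cubic hmn)
    refine Int.natCast_dvd.2 (?_ : 9 ∣ _)
    rw [hpow]
    exact ⟨3 ^ k, by ring⟩

theorem cubic_ne_zero {m n : ℤ} (hmn : IsCoprime m n) : m ^ 3 - 3 * m * n ^ 2 - n ^ 3 ≠ 0 :=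
  fun h => not_nine_dvd_cubic hmn (h ▸ dvd_zero _)

theorem f_div {m n : ℤ} (hn : n ≠ 0) :
    f (m / n) = ((3 ^ 7 * (m ^ 2 - n ^ 2) ^ 3 *
      (m ^ 6 + 3 * m ^ 5 * n + 6 * m ^ 4 * n ^ 2 + m ^ 3 * n ^ 3 - 3 * m ^ 2 * n ^ 4
        + 12 * m * n ^ 5 + 16 * n ^ 6) ^ 3 *
      (2 * m ^ 3 + 3 * m ^ 2 * n - 3 * m * n ^ 2 - 5 * n ^ 3) : ℤ) : ℚ) /
      ((m ^ 3 - 3 * m * n ^ 2 - n ^ 3 : ℤ) : ℚ) ^ 9 := by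
  have hn' : (n : ℚ) ≠ 0 := by exact_mod_cast hn
  have h1 : ((m : ℚ) / n) ^ 2 - 1 = (m ^ 2 - n ^ 2) / n ^ 2 := by field_simp
  have h2 : ((m : ℚ) / n) ^ 6 + 3 * (m / n) ^ 5 + 6 * (m / n) ^ 4 + (m / n) ^ 3
      - 3 * (m / n) ^ 2 + 12 * (m / n) + 16 =
      (m ^ 6 + 3 * m ^ 5 * n + 6 * m ^ 4 * n ^ 2 + m ^ 3 * n ^ 3 - 3 * m ^ 2 * n ^ 4
        + 12 * m * n ^ 5 + 16 * n ^ 6) / n ^ 6 := by field_simp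
  have h3 : 2 * ((m : ℚ) / n) ^ 3 + 3 * (m / n) ^ 2 - 3 * (m / n) - 5 =
      (2 * m ^ 3 + 3 * m ^ 2 * n - 3 * m * n ^ 2 - 5 * n ^ 3) / n ^ 3 := by field_simp
  have h4 : ((m : ℚ) / n) ^ 3 - 3 * (m / n) - 1 =
      (m ^ 3 - 3 * m * n ^ 2 - n ^ 3) / n ^ 3 := by field_simp
  rw [f, h1, h2, h3, h4]
  push_cast
  generalize (m ^ 2 - n ^ 2 : ℚ) = A
  generalize (m ^ 6 + 3 * m ^ 5 * n + 6 * m ^ 4 * n ^ 2 + m ^ 3 * n ^ 3 - 3 * m ^ 2 * n ^ 4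
    + 12 * m * n ^ 5 + 16 * n ^ 6 : ℚ) = B
  generalize (2 * m ^ 3 + 3 * m ^ 2 * n - 3 * m * n ^ 2 - 5 * n ^ 3 : ℚ) = C
  generalize (m ^ 3 - 3 * m * n ^ 2 - n ^ 3 : ℚ) = D
  field_simp
  ring

theorem cubic_of_f_integral {m n : ℤ} (hmn : IsCoprime m n) (hn : n ≠ 0) {k : ℤ}
    (hk : f (m / n) = k) :
    (m ^ 3 - 3 * m * n ^ 2 - n ^ 3).natAbs = 1 ∨ (m ^ 3 - 3 * m * n ^ 2 - n ^ 3).natAbs = 3 := by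
  have hF0 := cubic_ne_zero hmn
  refine natAbs_cubic_eq_one_or_three hmn hF0 ?_
  rw [f_div hn, div_eq_iff (pow_ne_zero _ (by exact_mod_cast hF0))] at hk
  refine ⟨k * (m ^ 3 - 3 * m * n ^ 2 - n ^ 3) ^ 8, Int.cast_injective (α := ℚ) ?_⟩
  rw [hk]
  push_cast
  ring

theorem quadratic_form_of_cubic_eq_three {m n : ℤ}
    (hF : (m ^ 3 - 3 * m * n ^ 2 - n ^ 3).natAbs = 3) : m ^ 2 + m * n + n ^ 2 = 3 := by
  have hF2 : (m ^ 3 - 3 * m * n ^ 2 - n ^ 3) ^ 2 = 9 := by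
    rw [← Int.natAbs_sq, hF]; norm_num
  have hsyz : (m ^ 3 + 6 * m ^ 2 * n + 3 * m * n ^ 2 - n ^ 3) ^ 2
      + 3 * (m ^ 3 - 3 * m * n ^ 2 - n ^ 3) ^ 2 = 4 * (m ^ 2 + m * n + n ^ 2) ^ 3 := by ring
  have hmod : (3 : ℤ) ∣ m - n := by
    have h3 : (3 : ℤ) ∣ m ^ 3 - 3 * m * n ^ 2 - n ^ 3 := by omega
    have h3' : (m : ZMod 3) ^ 3 - 3 * m * n ^ 2 - n ^ 3 = 0 := by
      exact_mod_cast (ZMod.intCast_zmod_eq_zero_iff_dvd _ 3).2 h3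
    have key : ∀ a b : ZMod 3, a ^ 3 - 3 * a * b ^ 2 - b ^ 3 = 0 → a - b = 0 := by decide
    exact (ZMod.intCast_zmod_eq_zero_iff_dvd _ 3).1 (by exact_mod_cast key _ _ h3')
  obtain ⟨t, ht⟩ := hmod
  obtain rfl : m = n + 3 * t := by omega
  have hh : (n + 3 * t) ^ 2 + (n + 3 * t) * n + n ^ 2 = 3 * (n ^ 2 + 3 * n * t + 3 * t ^ 2) := by
    ring
  have hg : (n + 3 * t) ^ 3 + 6 * (n + 3 * t) ^ 2 * n + 3 * (n + 3 * t) * n ^ 2 - n ^ 3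
      = 9 * (n ^ 3 + 6 * n ^ 2 * t + 9 * n * t ^ 2 + 3 * t ^ 3) := by ring
  rw [hF2, hh, hg] at hsyz
  rw [hh]
  generalize n ^ 2 + 3 * n * t + 3 * t ^ 2 = h at *
  generalize n ^ 3 + 6 * n ^ 2 * t + 9 * n * t ^ 2 + 3 * t ^ 3 = g at *
  have hflt : (1 + g) ^ 3 + (1 - g) ^ 3 = (2 * h) ^ 3 := by linarith
  have hh0 : h ≠ 0 := by
    rintro rfl
    nlinarith [sq_nonneg g]
  have hg1 : g ^ 2 = 1 := by
    by_contra hne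
    refine fermatLastTheoremFor_iff_int.1 fermatLastTheoremThree (1 + g) (1 - g) (2 * h)
      ?_ ?_ (mul_ne_zero two_ne_zero hh0) hflt
    · intro h0
      exact hne (by obtain rfl : g = -1 := by omega
                    norm_num)
    · intro h0
      exact hne (by obtain rfl : g = 1 := by omega
                    norm_num)
  have hh3 : h ^ 3 = 1 := by linarith
  have : h = 1 := by nlinarith [sq_nonneg (h - 1), sq_nonneg (h + 1)]
  omega

theorem bounds_of_quadratic_form {m n : ℤ} (h : m ^ 2 + m * n + n ^ 2 ≤ 7) :
    m ∈ Finset.Icc (-3) 3 ∧ n ∈ Finset.Icc (-3) 3 := by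
  simp only [Finset.mem_Icc]
  refine ⟨⟨?_, ?_⟩, ?_, ?_⟩ <;> nlinarith [sq_nonneg (m + 2 * n), sq_nonneg (2 * m + n)]

theorem eq_of_quadratic_form {m n : ℤ} (hn : 0 < n)
    (h : (m ^ 2 + m * n + n ^ 2 = 3 ∧ (m ^ 3 - 3 * m * n ^ 2 - n ^ 3).natAbs = 3) ∨
      ((m ^ 2 + m * n + n ^ 2 = 1 ∨ m ^ 2 + m * n + n ^ 2 = 7) ∧
        (m ^ 3 - 3 * m * n ^ 2 - n ^ 3).natAbs = 1)) :
    (m / n : ℚ) = 1 ∨ (m / n : ℚ) = -1 ∨ (m / n : ℚ) = -2 ∨ (m / n : ℚ) = 0 ∨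
      (m / n : ℚ) = -1/2 ∨ (m / n : ℚ) = 2 ∨ (m / n : ℚ) = -3/2 ∨ (m / n : ℚ) = -1/3 := by
  obtain ⟨hm, hn'⟩ := bounds_of_quadratic_form (m := m) (n := n) (by omega)
  simp only [Finset.mem_Icc] at hm hn'
  obtain ⟨hm1, hm2⟩ := hm
  obtain ⟨-, hn2⟩ := hn'
  interval_cases n <;> interval_cases m <;> revert h <;> norm_num

open NumberField in
theorem nrComplexPlaces_pos_of_trace_sq_neg {K : Type*} [Field K] [NumberField K] (z : K)
    (hz : Algebra.trace ℚ K (z ^ 2) < 0) : 0 < InfinitePlace.nrComplexPlaces K := by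
  rw [Nat.pos_iff_ne_zero, Ne, nrComplexPlaces_eq_zero_iff]
  intro hK
  have hsum := trace_eq_sum_embeddings (K := ℚ) (L := K) ℂ (x := z ^ 2)
  have hre := congrArg Complex.re hsum
  rw [Complex.re_sum] at hre
  have hnonneg : ∀ σ : K →ₐ[ℚ] ℂ, 0 ≤ (σ (z ^ 2)).re := by
    intro σ
    have hσ := IsTotallyReal.complexEmbedding_isReal (σ : K →+* ℂ)
    have h : (hσ.embedding z : ℂ) = σ z := hσ.coe_embedding_apply z
    rw [map_pow, ← h, ← Complex.ofReal_pow, Complex.ofReal_re]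
    positivity
  have := Finset.sum_nonneg fun σ (_ : σ ∈ Finset.univ) => hnonneg σ
  rw [← hre] at this
  have h2 : ((algebraMap ℚ ℂ) (Algebra.trace ℚ K (z ^ 2))).re
      = ((Algebra.trace ℚ K (z ^ 2) : ℚ) : ℝ) := by simp
  rw [h2] at this
  have : (0 : ℚ) ≤ Algebra.trace ℚ K (z ^ 2) := by exact_mod_cast this
  linarith

open NumberField in
theorem exists_zpow_prod_eq_one_of_rank_lt {K : Type*} [Field K] [NumberField K] {n : ℕ}
    (hn : Units.rank K < n) (u : Fin n → (𝓞 K)ˣ) :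
    ∃ e : Fin n → ℤ, e ≠ 0 ∧ ∏ i, u i ^ e i = 1 := by
  have hv : ¬ LinearIndependent ℤ fun i => Additive.ofMul (u i) := by
    intro h
    have := h.fintype_card_le_finrank
    rw [Units.finrank_eq, Fintype.card_fin] at this
    omega
  obtain ⟨g, hg, i, hi⟩ := Fintype.not_linearIndependent_iff.1 hv
  refine ⟨g, fun h => hi (congrFun h i), ?_⟩
  rw [← ofMul_eq_zero, ← hg, ofMul_prod]
  rfl

section Quartic

open Polynomial

/-- The quartic polynomial `X ^ 4 - 6 * X ^ 2 - 4 * X - 3`. -/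
noncomputable def quarticPoly (R : Type*) [CommRing R] : R[X] :=
  X ^ 4 - 6 * X ^ 2 - 4 * X - 3

theorem quarticPoly_eq (R : Type*) [CommRing R] :
    quarticPoly R = X ^ 4 + C (-6) * X ^ 2 + C (-4) * X + C (-3) := by
  simp only [quarticPoly, map_neg, map_ofNat]; ring

theorem natDegree_quarticPoly (R : Type*) [CommRing R] [Nontrivial R] :
    (quarticPoly R).natDegree = 4 := by
  rw [quarticPoly_eq]; compute_degree!

theorem monic_quarticPoly (R : Type*) [CommRing R] [Nontrivial R] : (quarticPoly R).Monic := by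
  rw [quarticPoly_eq]; monicity!

theorem irreducible_quarticPoly_int : Irreducible (quarticPoly ℤ) := by
  have hm := monic_quarticPoly ℤ
  have hd := natDegree_quarticPoly ℤ
  have h1 : quarticPoly ℤ ≠ 1 := by
    intro h; rw [h, natDegree_one] at hd; omega
  rw [hm.irreducible_iff_lt_natDegree_lt h1, hd]
  intro q hq hqd ⟨r, hr⟩
  have hrm : r.Monic := hq.of_mul_monic_left (hr ▸ hm)
  have hdeg : q.natDegree + r.natDegree = 4 := by
    rw [← hq.natDegree_mul hrm, ← hr, hd]
  rw [Finset.mem_Ioc] at hqd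
  obtain hq1 | hq2 : q.natDegree = 1 ∨ q.natDegree = 2 := by omega
  · rw [hq.eq_X_add_C hq1] at hr
    generalize q.coeff 0 = a at hr
    have h := congrArg (eval (-a)) hr
    simp only [quarticPoly, eval_sub, eval_mul, eval_add, eval_pow, eval_X, eval_C, eval_ofNat,
      neg_add_cancel, zero_mul] at h
    have h5 : ((-a : ℤ) : ZMod 5) ^ 4 - 6 * ((-a : ℤ) : ZMod 5) ^ 2
        - 4 * ((-a : ℤ) : ZMod 5) - 3 = 0 := by
      exact_mod_cast congrArg (Int.cast : ℤ → ZMod 5) h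
    generalize ((-a : ℤ) : ZMod 5) = t at h5
    revert t
    decide
  · have hr2 : r.natDegree = 2 := by omega
    have hquad : ∀ s : ℤ[X], s.Monic → s.natDegree = 2 →
        s = X ^ 2 + C (s.coeff 1) * X + C (s.coeff 0) := by
      intro s hs hs2
      have h1 : s.coeff 2 = 1 := by rw [← hs2]; exact hs
      conv_lhs => rw [eq_quadratic_of_degree_le_two (p := s) (natDegree_le_iff_degree_le.1 hs2.le)]
      rw [h1, C_1, one_mul]
    rw [hquad q hq hq2, hquad r hrm hr2] at hr
    generalize q.coeff 0 = b, q.coeff 1 = a, r.coeff 0 = d, r.coeff 1 = c at hr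
    have hexp : (X ^ 2 + C a * X + C b) * (X ^ 2 + C c * X + C d) =
        X ^ 4 + C (a + c) * X ^ 3 + C (b + d + a * c) * X ^ 2 + C (a * d + b * c) * X
          + C (b * d) := by
      simp only [map_add, map_mul]; ring
    rw [hexp, quarticPoly_eq] at hr
    have c0 := congrArg (coeff · 0) hr
    have c1 := congrArg (coeff · 1) hr
    have c2 := congrArg (coeff · 2) hr
    have c3 := congrArg (coeff · 3) hr
    simp only [coeff_add, coeff_C_mul, coeff_X_pow, coeff_X, coeff_C] at c0 c1 c2 c3
    norm_num at c0 c1 c2 c3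
    have key : ∀ a b c d : ZMod 5, -3 = b * d → -4 = a * d + b * c → -6 = b + d + a * c →
        0 = a + c → False := by decide
    exact key a b c d (by exact_mod_cast congrArg (Int.cast : ℤ → ZMod 5) c0)
      (by exact_mod_cast congrArg (Int.cast : ℤ → ZMod 5) c1)
      (by exact_mod_cast congrArg (Int.cast : ℤ → ZMod 5) c2)
      (by exact_mod_cast congrArg (Int.cast : ℤ → ZMod 5) c3)

theorem eval₂_quarticPoly {R S : Type*} [CommRing R] [CommRing S] (φ : R →+* S) (x : S) :
    (quarticPoly R).eval₂ φ x = x ^ 4 - 6 * x ^ 2 - 4 * x - 3 := by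
  simp [quarticPoly, eval₂_sub]

theorem irreducible_quarticPoly_rat : Irreducible (quarticPoly ℚ) := by
  have h := ((monic_quarticPoly ℤ).irreducible_iff_irreducible_map_fraction_map (K := ℚ)).1
    irreducible_quarticPoly_int
  simpa [quarticPoly] using h

instance : Fact (Irreducible (quarticPoly ℚ)) := ⟨irreducible_quarticPoly_rat⟩

/-- The number field generated by a root of `X ^ 4 - 6 * X ^ 2 - 4 * X - 3`. -/
abbrev QuarticField : Type := AdjoinRoot (quarticPoly ℚ)

namespace QuarticField

instance : FiniteDimensional ℚ QuarticField :=
  (monic_quarticPoly ℚ).finite_adjoinRoot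

instance : NumberField QuarticField where

/-- The generator of `QuarticField`. -/
noncomputable def α : QuarticField := AdjoinRoot.root (quarticPoly ℚ)

theorem α_pow_four : α ^ 4 = 6 * α ^ 2 + 4 * α + 3 := by
  have h := AdjoinRoot.eval₂_root (quarticPoly ℚ)
  rw [eval₂_quarticPoly] at h
  change α ^ 4 - 6 * α ^ 2 - 4 * α - 3 = 0 at h
  linear_combination h

/-- The power basis `1, α, α ^ 2, α ^ 3`. -/
noncomputable def basis : Module.Basis (Fin 4) ℚ QuarticField :=
  (AdjoinRoot.powerBasis irreducible_quarticPoly_rat.ne_zero).basis.reindex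
    (finCongr (by rw [AdjoinRoot.powerBasis_dim, natDegree_quarticPoly]))

theorem basis_apply (i : Fin 4) : basis i = α ^ (i : ℕ) := by
  simp [basis, α]

theorem finrank_eq : Module.finrank ℚ QuarticField = 4 := by
  simpa using Module.finrank_eq_card_basis basis

/-- The element of `QuarticField` with prescribed coordinates. -/
noncomputable def ofCoords (a b c d : ℚ) : QuarticField :=
  algebraMap ℚ _ a + algebraMap ℚ _ b * α + algebraMap ℚ _ c * α ^ 2 + algebraMap ℚ _ d * α ^ 3

theorem repr_ofCoords (a b c d : ℚ) : basis.repr (ofCoords a b c d) = ![a, b, c, d] := by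
  have h : ofCoords a b c d = a • basis 0 + b • basis 1 + c • basis 2 + d • basis 3 := by
    simp [ofCoords, basis_apply, Algebra.smul_def]
  rw [h]
  ext i
  fin_cases i <;> simp

theorem trace_ofCoords (a b c d : ℚ) :
    Algebra.trace ℚ QuarticField (ofCoords a b c d) = 4 * a + 12 * c + 12 * d := by
  rw [Algebra.trace_eq_matrix_trace basis, Matrix.trace, Fin.sum_univ_four]
  simp only [Matrix.diag_apply, Algebra.leftMulMatrix_eq_repr_mul, basis_apply]
  have h0 : ofCoords a b c d * α ^ ((0 : Fin 4) : ℕ) = ofCoords a b c d := by simp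
  have h1 : ofCoords a b c d * α ^ ((1 : Fin 4) : ℕ) =
      ofCoords (3 * d) (a + 4 * d) (b + 6 * d) c := by
    simp only [ofCoords, map_add, map_mul, map_ofNat, Fin.val_one]
    linear_combination (algebraMap ℚ QuarticField d) * α_pow_four
  have h2 : ofCoords a b c d * α ^ ((2 : Fin 4) : ℕ) =
      ofCoords (3 * c) (4 * c + 3 * d) (a + 6 * c + 4 * d) (b + 6 * d) := by
    simp only [ofCoords, map_add, map_mul, map_ofNat, Fin.val_two]
    linear_combination (algebraMap ℚ QuarticField c + algebraMap ℚ QuarticField d * α) * α_pow_four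
  have h3 : ofCoords a b c d * α ^ ((3 : Fin 4) : ℕ) =
      ofCoords (3 * b + 18 * d) (4 * b + 3 * c + 24 * d) (6 * b + 4 * c + 39 * d)
        (a + 6 * c + 4 * d) := by
    have : ((3 : Fin 4) : ℕ) = 3 := rfl
    simp only [ofCoords, map_add, map_mul, map_ofNat, this]
    linear_combination (algebraMap ℚ QuarticField b + algebraMap ℚ QuarticField c * α
      + algebraMap ℚ QuarticField d * (α ^ 2 + 6)) * α_pow_four
  rw [h0, h1, h2, h3]
  simp only [repr_ofCoords]
  simp
  ring

open NumberField in
theorem rank_le_two : Units.rank QuarticField ≤ 2 := by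
  have hpos : 0 < InfinitePlace.nrComplexPlaces QuarticField := by
    refine nrComplexPlaces_pos_of_trace_sq_neg (ofCoords (-1) (-6) 0 1) ?_
    have : ofCoords (-1) (-6) 0 1 ^ 2 = ofCoords (-17) (-12) 3 2 := by
      simp only [ofCoords, map_one, map_zero, map_neg, map_ofNat]
      linear_combination (α ^ 2 - 6) * α_pow_four
    rw [this, trace_ofCoords]
    norm_num
  have h1 := InfinitePlace.card_add_two_mul_card_eq_rank QuarticField
  have h2 := InfinitePlace.card_eq_nrRealPlaces_add_nrComplexPlaces QuarticField
  rw [finrank_eq] at h1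
  rw [Units.rank]
  omega

end QuarticField

end Quartic

section LeadingTerm

variable {L : Type*} [Field L] (A : Subring L)

/-- `x` is congruent to `1 + 2 ^ s * w` modulo `2 ^ (s + 1) * A`. -/
def HasLeadingTerm (s : ℕ) (w x : L) : Prop := ∃ y ∈ A, x = 1 + 2 ^ s * (w + 2 * y)

namespace HasLeadingTerm

variable {A} {s : ℕ} {w x w' x' : L}

theorem one : HasLeadingTerm A s 0 1 := ⟨0, A.zero_mem, by simp⟩

theorem mul (hw : w ∈ A) (hw' : w' ∈ A) (h : HasLeadingTerm A (s + 1) w x)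
    (h' : HasLeadingTerm A (s + 1) w' x') : HasLeadingTerm A (s + 1) (w + w') (x * x') := by
  obtain ⟨y, hy, rfl⟩ := h
  obtain ⟨y', hy', rfl⟩ := h'
  have h2 : (2 : L) ∈ A := ofNat_mem A 2
  refine ⟨y + y' + 2 ^ s * ((w + 2 * y) * (w' + 2 * y')), ?_, by ring⟩
  exact A.add_mem (A.add_mem hy hy') (A.mul_mem (A.pow_mem h2 s) (A.mul_mem
    (A.add_mem hw (A.mul_mem h2 hy)) (A.add_mem hw' (A.mul_mem h2 hy'))))

theorem inv (hw : w ∈ A) (hx : x ≠ 0) (hx' : x⁻¹ ∈ A) (h : HasLeadingTerm A (s + 1) w x) :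
    HasLeadingTerm A (s + 1) (-w) x⁻¹ := by
  obtain ⟨y, hy, hxy⟩ := h
  have h2 : (2 : L) ∈ A := ofNat_mem A 2
  refine ⟨-y + 2 ^ s * ((w + 2 * y) ^ 2 * x⁻¹), ?_, ?_⟩
  · exact A.add_mem (A.neg_mem hy) (A.mul_mem (A.pow_mem h2 s) (A.mul_mem
      (A.pow_mem (A.add_mem hw (A.mul_mem h2 hy)) 2) hx'))
  · have hinv : x * x⁻¹ = 1 := mul_inv_cancel₀ hx
    generalize x⁻¹ = z at *
    subst hxy
    linear_combination (1 - 2 ^ (s + 1) * (w + 2 * y)) * hinv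

theorem sq (hw : w ∈ A) (h : HasLeadingTerm A (s + 2) w x) :
    HasLeadingTerm A (s + 2 + 1) w (x ^ 2) := by
  obtain ⟨y, hy, rfl⟩ := h
  have h2 : (2 : L) ∈ A := ofNat_mem A 2
  refine ⟨y + 2 ^ s * (w + 2 * y) ^ 2, ?_, by ring⟩
  exact A.add_mem hy (A.mul_mem (A.pow_mem h2 s)
    (A.pow_mem (A.add_mem hw (A.mul_mem h2 hy)) 2))

theorem pow_two_pow (hw : w ∈ A) (h : HasLeadingTerm A (s + 2) w x) (k : ℕ) :
    HasLeadingTerm A (s + 2 + k) w (x ^ 2 ^ k) := by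
  induction k with
  | zero => simpa using h
  | succ k ih =>
    rw [pow_succ 2 k, pow_mul, show s + 2 + (k + 1) = s + k + 2 + 1 by omega]
    rw [show s + 2 + k = s + k + 2 by omega] at ih
    exact ih.sq hw

theorem zpow (hw : w ∈ A) (hx : x ≠ 0) (hx' : x⁻¹ ∈ A) (h : HasLeadingTerm A (s + 1) w x)
    (n : ℤ) : HasLeadingTerm A (s + 1) (n * w) (x ^ n) := by
  have hmem : ∀ n : ℤ, (n : L) * w ∈ A := fun n => A.mul_mem (intCast_mem A n) hw
  induction n using Int.induction_on with
  | zero => simpa using one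
  | succ n ih =>
    rw [zpow_add_one₀ hx]
    have := ih.mul (hmem _) hw h
    push_cast at this ⊢
    rwa [add_mul, one_mul]
  | pred n ih =>
    rw [zpow_sub_one₀ hx]
    have := ih.mul (hmem _) (A.neg_mem hw) (h.inv hw hx hx')
    push_cast at this ⊢
    rwa [sub_mul, one_mul, sub_eq_add_neg]

theorem prod_zpow {r : ℕ} {w x : Fin r → L} (hw : ∀ i, w i ∈ A) (hx : ∀ i, x i ≠ 0)
    (hx' : ∀ i, (x i)⁻¹ ∈ A) (h : ∀ i, HasLeadingTerm A (s + 1) (w i) (x i)) (n : Fin r → ℤ) :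
    HasLeadingTerm A (s + 1) (∑ i, (n i : L) * w i) (∏ i, x i ^ n i) := by
  have hmem : ∀ i, (n i : L) * w i ∈ A := fun i => A.mul_mem (intCast_mem A _) (hw i)
  induction (Finset.univ : Finset (Fin r)) using Finset.induction_on with
  | empty => simpa using one
  | insert i t hi ih =>
    rw [Finset.sum_insert hi, Finset.prod_insert hi]
    exact ((h i).zpow (hw i) (hx i) (hx' i) (n i)).mul (hmem i)
      (A.sum_mem fun j _ => hmem j) ih

/-- Units whose leading terms at a common level are independent modulo `2` are multiplicatively
independent. -/
theorem eq_zero_of_prod_zpow_eq_one [CharZero L] {r : ℕ} {w x : Fin r → L} (hw : ∀ i, w i ∈ A)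
    (hx : ∀ i, x i ≠ 0) (hx' : ∀ i, (x i)⁻¹ ∈ A)
    (h : ∀ i, HasLeadingTerm A (s + 2) (w i) (x i))
    (hind : ∀ n : Fin r → ℤ, ∀ y ∈ A, ∑ i, (n i : L) * w i = 2 * y → ∀ i, 2 ∣ n i)
    (hA : ∀ y ∈ A, 2 * y ≠ 1) {n : Fin r → ℤ} (hn : ∏ i, x i ^ n i = 1) : n = 0 := by
  have h2 : (2 : L) ∈ A := ofNat_mem A 2
  have hdvd : ∀ k : ℕ, ∀ n : Fin r → ℤ, ∏ i, x i ^ n i = 1 → ∀ i, 2 ^ k ∣ n i := by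
    intro k
    induction k with
    | zero => simp
    | succ k ih =>
      intro n hn
      have hev : ∀ i, 2 ∣ n i := by
        obtain ⟨y, hy, hy'⟩ := prod_zpow hw hx hx' h n
        rw [hn, left_eq_add, mul_eq_zero] at hy'
        refine hind n (-y) (A.neg_mem hy) ?_
        linear_combination hy'.resolve_left (pow_ne_zero _ two_ne_zero)
      choose m hm using hev
      have hsq : (∏ i, x i ^ m i) ^ 2 = 1 := by
        rw [← hn, ← Finset.prod_pow]
        refine Finset.prod_congr rfl fun i _ => ?_
        rw [hm i, mul_comm, zpow_mul, zpow_ofNat]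
      have hm1 : ∏ i, x i ^ m i = 1 := by
        refine (mul_self_eq_one_iff.1 ((pow_two _).symm.trans hsq)).resolve_right fun hneg => ?_
        obtain ⟨y, hy, hy'⟩ := prod_zpow hw hx hx' h m
        rw [hneg] at hy'
        refine hA (-(2 ^ s * (∑ i, (m i : L) * w i + 2 * y))) (A.neg_mem (A.mul_mem
          (A.pow_mem h2 s) (A.add_mem (A.sum_mem fun i _ => A.mul_mem (intCast_mem A _) (hw i))
            (A.mul_mem h2 hy)))) ?_
        have h20 : (2 : L) ≠ 0 := two_ne_zero
        apply mul_left_cancel₀ h20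
        linear_combination hy'
      intro i
      rw [hm i, pow_succ']
      exact mul_dvd_mul_left 2 (ih m hm1 i)
  funext i
  refine Int.eq_zero_of_abs_lt_dvd (hdvd (n i).natAbs n hn i) ?_
  rw [Int.abs_eq_natAbs]
  exact_mod_cast (n i).natAbs.lt_two_pow_self

end HasLeadingTerm

end LeadingTerm

namespace QuarticField

open NumberField

theorem ofCoords_mul (a b c d a' b' c' d' : ℚ) :
    ofCoords a b c d * ofCoords a' b' c' d' =
      ofCoords (a * a' + 3 * (b * d' + c * c' + d * b') + 18 * (d * d'))
        (a * b' + b * a' + 4 * (b * d' + c * c' + d * b') + 3 * (c * d' + d * c') + 24 * (d * d'))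
        (a * c' + b * b' + c * a' + 6 * (b * d' + c * c' + d * b') + 4 * (c * d' + d * c')
          + 39 * (d * d'))
        (a * d' + b * c' + c * b' + d * a' + 6 * (c * d' + d * c') + 4 * (d * d')) := by
  simp only [ofCoords, map_add, map_mul, map_ofNat]
  generalize algebraMap ℚ QuarticField a = a, algebraMap ℚ QuarticField b = b,
    algebraMap ℚ QuarticField c = c, algebraMap ℚ QuarticField d = d,
    algebraMap ℚ QuarticField a' = a', algebraMap ℚ QuarticField b' = b',
    algebraMap ℚ QuarticField c' = c', algebraMap ℚ QuarticField d' = d'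
  linear_combination ((b * d' + c * c' + d * b') + (c * d' + d * c') * α
    + (d * d') * (α ^ 2 + 6)) * α_pow_four

theorem ofCoords_injective {a b c d a' b' c' d' : ℚ}
    (h : ofCoords a b c d = ofCoords a' b' c' d') : a = a' ∧ b = b' ∧ c = c' ∧ d = d' := by
  have h := congrArg (fun x => (basis.repr x : Fin 4 → ℚ)) h
  simp only [repr_ofCoords] at h
  exact ⟨congrFun h 0, congrFun h 1, congrFun h 2, congrFun h 3⟩

/-- The order `ℤ[α]`. -/
def order : Subring QuarticField where
  carrier := {x | ∃ a b c d : ℤ, x = ofCoords a b c d}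
  mul_mem' := by
    rintro _ _ ⟨a, b, c, d, rfl⟩ ⟨a', b', c', d', rfl⟩
    rw [ofCoords_mul]
    exact ⟨a * a' + 3 * (b * d' + c * c' + d * b') + 18 * (d * d'),
      a * b' + b * a' + 4 * (b * d' + c * c' + d * b') + 3 * (c * d' + d * c') + 24 * (d * d'),
      a * c' + b * b' + c * a' + 6 * (b * d' + c * c' + d * b') + 4 * (c * d' + d * c')
        + 39 * (d * d'),
      a * d' + b * c' + c * b' + d * a' + 6 * (c * d' + d * c') + 4 * (d * d'), by norm_cast⟩
  one_mem' := ⟨1, 0, 0, 0, by simp [ofCoords]⟩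
  add_mem' := by
    rintro _ _ ⟨a, b, c, d, rfl⟩ ⟨a', b', c', d', rfl⟩
    refine ⟨a + a', b + b', c + c', d + d', ?_⟩
    simp only [ofCoords, Int.cast_add, map_add]
    ring
  zero_mem' := ⟨0, 0, 0, 0, by simp [ofCoords]⟩
  neg_mem' := by
    rintro _ ⟨a, b, c, d, rfl⟩
    refine ⟨-a, -b, -c, -d, ?_⟩
    simp only [ofCoords, Int.cast_neg, map_neg]
    ring

theorem mem_order (a b c d : ℤ) : ofCoords a b c d ∈ order := ⟨a, b, c, d, rfl⟩

theorem isIntegral_of_mem_order {x : QuarticField} (hx : x ∈ order) : IsIntegral ℤ x := by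
  obtain ⟨a, b, c, d, rfl⟩ := hx
  have hα : IsIntegral ℤ α := by
    refine ⟨quarticPoly ℤ, monic_quarticPoly ℤ, ?_⟩
    rw [eval₂_quarticPoly]
    linear_combination α_pow_four
  have hint : ∀ n : ℤ, IsIntegral ℤ (algebraMap ℚ QuarticField n) := fun n => by
    rw [map_intCast]
    exact isIntegral_algebraMap (x := n)
  exact (((hint a).add ((hint b).mul hα)).add ((hint c).mul (hα.pow 2))).add
    ((hint d).mul (hα.pow 3))

/-- An invertible element of `ℤ[α]` as a unit of the ring of integers. -/
noncomputable def unitOfMem {x : QuarticField} (hx : x ∈ order) (hx' : x⁻¹ ∈ order) (h0 : x ≠ 0) :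
    (𝓞 QuarticField)ˣ where
  val := ⟨x, isIntegral_of_mem_order hx⟩
  inv := ⟨x⁻¹, isIntegral_of_mem_order hx'⟩
  val_inv := RingOfIntegers.ext (mul_inv_cancel₀ h0)
  inv_val := RingOfIntegers.ext (inv_mul_cancel₀ h0)

/-- There are no three invertible elements of `ℤ[α]` with independent leading terms. -/
theorem false_of_leadingTerms {s : ℕ} {w x : Fin 3 → QuarticField}
    (hw : ∀ i, w i ∈ order) (hx : ∀ i, x i ∈ order) (hx' : ∀ i, (x i)⁻¹ ∈ order)
    (hx0 : ∀ i, x i ≠ 0) (h : ∀ i, HasLeadingTerm order (s + 2) (w i) (x i))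
    (hind : ∀ n : Fin 3 → ℤ, ∀ y ∈ order, ∑ i, (n i : QuarticField) * w i = 2 * y →
      ∀ i, 2 ∣ n i) : False := by
  obtain ⟨e, he0, he⟩ := exists_zpow_prod_eq_one_of_rank_lt (K := QuarticField) (n := 3)
    (by have := rank_le_two; omega) fun i => unitOfMem (hx i) (hx' i) (hx0 i)
  refine he0 (HasLeadingTerm.eq_zero_of_prod_zpow_eq_one hw hx0 hx' h hind ?_ ?_)
  · rintro _ ⟨a, b, c, d, rfl⟩ hy
    have h2 : (2 : QuarticField) = ofCoords 2 0 0 0 := by simp [ofCoords]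
    have h1 : (1 : QuarticField) = ofCoords 1 0 0 0 := by simp [ofCoords]
    rw [h2, h1, ofCoords_mul] at hy
    have := (ofCoords_injective hy).1
    norm_num at this
    have : 2 * a = 1 := by exact_mod_cast this
    omega
  · have h := congrArg (fun u : (𝓞 QuarticField)ˣ =>
      (Units.map (algebraMap (𝓞 QuarticField) QuarticField).toMonoidHom u : QuarticField)) he
    simp only [map_prod, map_zpow, map_one, Units.coe_prod, Units.val_zpow_eq_zpow_val,
      Units.val_one] at h
    exact h

theorem leadingTerm_ofCoords {s : ℕ} {a b c d a₁ b₁ c₁ d₁ : ℤ} (w₀ w₁ w₂ w₃ : ℤ)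
    (ha : a = 1 + 2 ^ s * (w₀ + 2 * a₁)) (hb : b = 2 ^ s * (w₁ + 2 * b₁))
    (hc : c = 2 ^ s * (w₂ + 2 * c₁)) (hd : d = 2 ^ s * (w₃ + 2 * d₁)) :
    HasLeadingTerm order s (ofCoords w₀ w₁ w₂ w₃) (ofCoords a b c d) := by
  refine ⟨ofCoords a₁ b₁ c₁ d₁, mem_order .., ?_⟩
  subst ha hb hc hd
  simp only [ofCoords, map_intCast]
  push_cast
  ring

theorem ofCoords_eq_one : ofCoords 1 0 0 0 = 1 := by simp [ofCoords]

theorem inv_eq_of_mul_eq {x y : QuarticField} (h : x * y = 1) : x⁻¹ = y ∧ x ≠ 0 :=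
  ⟨inv_eq_of_mul_eq_one_right h, left_ne_zero_of_mul_eq_one h⟩

theorem pow_eight_fundamental₁ :
    ofCoords 5 1 (-1) 0 ^ 8 = ofCoords 256933 734384 28092 (-115784) := by
  have h : ∀ x : QuarticField, x ^ 8 = ((x * x) * (x * x)) * ((x * x) * (x * x)) := fun x => by ring
  rw [h]
  norm_num [ofCoords_mul]

theorem mul_inv_fundamental₁ : ofCoords 5 1 (-1) 0 * ofCoords (-1) (-2) (-3) (-1) = 1 := by
  rw [ofCoords_mul, ← ofCoords_eq_one]; norm_num

theorem sq_fundamental₂ : ofCoords (-1) (-4) (-6) (-2) ^ 2 = ofCoords 229 384 592 212 := by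
  rw [pow_two, ofCoords_mul]; norm_num

theorem mul_inv_fundamental₂ :
    ofCoords (-1) (-4) (-6) (-2) * ofCoords (-13) (-12) (-22) 10 = 1 := by
  rw [ofCoords_mul, ← ofCoords_eq_one]; norm_num

theorem hasLeadingTerm_pow_eight_fundamental₁ :
    HasLeadingTerm order (0 + 2) (ofCoords 1 0 1 0) (ofCoords 5 1 (-1) 0 ^ 8) := by
  rw [pow_eight_fundamental₁]
  exact_mod_cast leadingTerm_ofCoords (s := 2) 1 0 1 0 (a₁ := 32116) (b₁ := 91798) (c₁ := 3511)
    (d₁ := -14473) rfl rfl rfl rfl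

theorem hasLeadingTerm_sq_fundamental₂ :
    HasLeadingTerm order (0 + 2) (ofCoords 1 0 0 1) (ofCoords (-1) (-4) (-6) (-2) ^ 2) := by
  rw [sq_fundamental₂]
  exact_mod_cast leadingTerm_ofCoords (s := 2) 1 0 0 1 (a₁ := 28) (b₁ := 48) (c₁ := 74)
    (d₁ := 26) rfl rfl rfl rfl

/-- There is no unit `q - p * α` of `ℤ[α]` with `q` odd, `4 ∣ p` and `p ≠ 0`. -/
theorem false_of_unit {p q k : ℤ} {r : ℕ} (hp : Odd p) (hq : Odd q)
    (hk : q ^ 2 = 1 + 2 ^ (2 * r + 4) * k)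
    (hG : q ^ 4 - 6 * (2 ^ (r + 2) * p) ^ 2 * q ^ 2 - 4 * (2 ^ (r + 2) * p) ^ 3 * q
      - 3 * (2 ^ (r + 2) * p) ^ 4 = 1) : False := by
  set P : ℤ := 2 ^ (r + 2) * p with hP
  have hu : ofCoords q (-P : ℤ) 0 0 *
      ofCoords (q ^ 3 - 6 * q * P ^ 2 - 4 * P ^ 3 : ℤ) (q ^ 2 * P - 6 * P ^ 3 : ℤ) (q * P ^ 2 : ℤ)
        (P ^ 3 : ℤ) = 1 := by
    have hG' : (q : ℚ) ^ 4 - 6 * P ^ 2 * q ^ 2 - 4 * P ^ 3 * q - 3 * P ^ 4 = 1 := by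
      exact_mod_cast hG
    rw [ofCoords_mul, ← ofCoords_eq_one]
    push_cast
    congr 1
    · linear_combination hG'
    all_goals ring
  have hu2 : ofCoords q (-P : ℤ) 0 0 ^ 2 = ofCoords (q ^ 2 : ℤ) (-2 * P * q : ℤ) (P ^ 2 : ℤ) 0 := by
    rw [pow_two, ofCoords_mul]
    push_cast
    congr 1 <;> ring
  have hodd : Odd (-(p * q)) := (hp.mul hq).neg
  obtain ⟨z, hz⟩ := hodd
  have hlead : HasLeadingTerm order (r + 1 + 2) (ofCoords 0 1 0 0)
      (ofCoords q (-P : ℤ) 0 0 ^ 2) := by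
    rw [hu2]
    have := leadingTerm_ofCoords (s := r + 1 + 2) (a := q ^ 2) (b := -2 * P * q) (c := P ^ 2)
      (d := 0) 0 1 0 0 (a₁ := 2 ^ r * k) (b₁ := z) (c₁ := 2 ^ r * p ^ 2) (d₁ := 0)
      (by rw [hk]; ring) (by rw [hP]; linear_combination 2 ^ (r + 3) * hz) (by rw [hP]; ring)
      (by ring)
    exact_mod_cast this
  have hm (a b c d : ℤ) := mem_order a b c d
  obtain ⟨hi0, h00⟩ := inv_eq_of_mul_eq hu
  obtain ⟨hi1, h01⟩ := inv_eq_of_mul_eq mul_inv_fundamental₁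
  obtain ⟨hi2, h02⟩ := inv_eq_of_mul_eq mul_inv_fundamental₂
  have hmu : ofCoords q (-P : ℤ) 0 0 ∈ order := by exact_mod_cast hm q (-P) 0 0
  have hmu1 : ofCoords 5 1 (-1) 0 ∈ order := by exact_mod_cast hm 5 1 (-1) 0
  have hmu2 : ofCoords (-1) (-4) (-6) (-2) ∈ order := by exact_mod_cast hm (-1) (-4) (-6) (-2)
  have hmi1 : (ofCoords 5 1 (-1) 0)⁻¹ ∈ order := by
    rw [hi1]; exact_mod_cast hm (-1) (-2) (-3) (-1)
  have hmi2 : (ofCoords (-1) (-4) (-6) (-2))⁻¹ ∈ order := by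
    rw [hi2]; exact_mod_cast hm (-13) (-12) (-22) 10
  have hmw0 : ofCoords 0 1 0 0 ∈ order := by exact_mod_cast hm 0 1 0 0
  have hmw1 : ofCoords 1 0 1 0 ∈ order := by exact_mod_cast hm 1 0 1 0
  have hmw2 : ofCoords 1 0 0 1 ∈ order := by exact_mod_cast hm 1 0 0 1
  have hl1 := hasLeadingTerm_pow_eight_fundamental₁.pow_two_pow hmw1 (r + 1)
  have hl2 := hasLeadingTerm_sq_fundamental₂.pow_two_pow hmw2 (r + 1)
  rw [show 0 + 2 + (r + 1) = r + 1 + 2 by omega] at hl1 hl2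
  refine false_of_leadingTerms (s := r + 1)
    (w := ![ofCoords 0 1 0 0, ofCoords 1 0 1 0, ofCoords 1 0 0 1])
    (x := ![ofCoords q (-P : ℤ) 0 0 ^ 2, (ofCoords 5 1 (-1) 0 ^ 8) ^ 2 ^ (r + 1),
      (ofCoords (-1) (-4) (-6) (-2) ^ 2) ^ 2 ^ (r + 1)]) ?_ ?_ ?_ ?_ ?_ ?_
  · simp [Fin.forall_fin_succ, hmw0, hmw1, hmw2]
  · simp only [Fin.forall_fin_succ, Matrix.cons_val_zero, Matrix.cons_val_succ, IsEmpty.forall_iff,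
      and_true]
    exact ⟨pow_mem hmu _, pow_mem (pow_mem hmu1 _) _, pow_mem (pow_mem hmu2 _) _⟩
  · simp only [Fin.forall_fin_succ, Matrix.cons_val_zero, Matrix.cons_val_succ, IsEmpty.forall_iff,
      and_true, ← inv_pow]
    exact ⟨pow_mem (hi0 ▸ mem_order ..) _, pow_mem (pow_mem hmi1 _) _, pow_mem (pow_mem hmi2 _) _⟩
  · simp only [Fin.forall_fin_succ, Matrix.cons_val_zero, Matrix.cons_val_succ, IsEmpty.forall_iff,
      and_true]
    exact ⟨pow_ne_zero _ h00, pow_ne_zero _ (pow_ne_zero _ h01), pow_ne_zero _ (pow_ne_zero _ h02)⟩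
  · simp only [Fin.forall_fin_succ, Matrix.cons_val_zero, Matrix.cons_val_succ, IsEmpty.forall_iff,
      and_true]
    exact ⟨hlead, hl1, hl2⟩
  · rintro n _ ⟨a, b, c, d, rfl⟩ h
    have h' : ofCoords (n 1 + n 2) (n 0) (n 1) (n 2) =
        ofCoords (2 * a) (2 * b) (2 * c) (2 * d) := by
      rw [Fin.sum_univ_three] at h
      simp only [ofCoords, Matrix.cons_val, map_add, map_mul, map_zero, map_one, map_ofNat,
        map_intCast] at h ⊢
      linear_combination h
    obtain ⟨-, h0, h1, h2⟩ := ofCoords_injective h'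
    have h0 : n 0 = 2 * b := by exact_mod_cast h0
    have h1 : n 1 = 2 * c := by exact_mod_cast h1
    have h2 : n 2 = 2 * d := by exact_mod_cast h2
    simp [Fin.forall_fin_succ, h0, h1, h2]

end QuarticField

/-- The Thue equation
`q ^ 4 - 6 * p ^ 2 * q ^ 2 - 4 * p ^ 3 * q - 3 * p ^ 4 = 1` has only the trivial solutions. -/
theorem eq_zero_of_quartic_eq_one {p q : ℤ}
    (hG : q ^ 4 - 6 * p ^ 2 * q ^ 2 - 4 * p ^ 3 * q - 3 * p ^ 4 = 1) : p = 0 := by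
  by_contra hp0
  have h16 : ∀ p q : ZMod 16, q ^ 4 - 6 * p ^ 2 * q ^ 2 - 4 * p ^ 3 * q - 3 * p ^ 4 = 1 →
      4 * p = 0 ∧ 8 * q = 8 := by decide
  obtain ⟨h1, h2⟩ := h16 p q (by exact_mod_cast congrArg (Int.cast : ℤ → ZMod 16) hG)
  have h4 : (4 : ℤ) ∣ p := by
    have := (ZMod.intCast_zmod_eq_zero_iff_dvd (4 * p) 16).1 (by push_cast; exact h1)
    omega
  have hq : Odd q := by
    have := (ZMod.intCast_eq_intCast_iff_dvd_sub 8 (8 * q) 16).1 (by push_cast; exact h2.symm)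
    rw [Int.odd_iff]
    omega
  obtain ⟨p', hpp', hp'⟩ := (Int.finiteMultiplicity_iff.2 ⟨by decide, hp0⟩ :
    FiniteMultiplicity (2 : ℤ) p).exists_eq_pow_mul_and_not_dvd
  generalize multiplicity 2 p = t at hpp'
  subst hpp'
  replace hp' : Odd p' := by rwa [← Int.not_even_iff_odd, even_iff_two_dvd]
  obtain ⟨r, rfl⟩ : ∃ r, t = r + 2 := by
    refine Nat.exists_eq_add_of_le' (Nat.le_of_not_lt fun ht => ?_)
    rw [Int.odd_iff] at hp'
    interval_cases t <;> norm_num at h4 <;> omega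
  obtain ⟨w, hw⟩ := h4
  obtain ⟨v, hv⟩ := hq
  have hdvd : (2 : ℤ) ^ (2 * r + 4) ∣ (q ^ 2 - 1) * (2 * (v ^ 2 + v) + 1) := by
    refine ⟨p' ^ 2 * (3 * q ^ 2 + 2 * (2 ^ (r + 2) * p') * q + 24 * w ^ 2), ?_⟩
    have h : (2 : ℤ) * ((q ^ 2 - 1) * (2 * (v ^ 2 + v) + 1)) = 2 * (2 ^ (2 * r + 4) *
        (p' ^ 2 * (3 * q ^ 2 + 2 * (2 ^ (r + 2) * p') * q + 24 * w ^ 2))) := by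
      have hq2 : 2 * (2 * (v ^ 2 + v) + 1) = q ^ 2 + 1 := by rw [hv]; ring
      have hpp : (2 : ℤ) ^ (2 * r + 4) * p' ^ 2 = (2 ^ (r + 2) * p') ^ 2 := by ring
      rw [← mul_assoc (2 ^ (2 * r + 4)), hpp]
      generalize (2 : ℤ) ^ (r + 2) * p' = p at *
      linear_combination (q ^ 2 - 1) * hq2 + hG + 3 * p ^ 2 * (p + 4 * w) * hw
    exact mul_left_cancel₀ two_ne_zero h
  have hcop : IsCoprime ((2 : ℤ) ^ (2 * r + 4)) (2 * (v ^ 2 + v) + 1) :=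
    IsCoprime.pow_left ⟨-(v ^ 2 + v), 1, by ring⟩
  obtain ⟨k, hk⟩ := hcop.dvd_of_dvd_mul_right hdvd
  exact QuarticField.false_of_unit (k := k) hp' ⟨v, hv⟩ (by linear_combination hk) hG

section Cubic

open Polynomial NumberField

theorem irreducible_X_pow_three_sub_C_six : Irreducible (X ^ 3 - C 6 : ℚ[X]) := by
  refine X_pow_sub_C_irreducible_of_prime Nat.prime_three fun b hb => ?_
  have hint : IsIntegral ℤ b := by
    refine ⟨X ^ 3 - C 6, monic_X_pow_sub_C _ three_ne_zero, ?_⟩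
    simp [eval₂_sub, hb]
  obtain ⟨n, rfl⟩ := IsIntegrallyClosed.isIntegral_iff.1 hint
  have hn : n ^ 3 = 6 := by
    rw [eq_intCast] at hb
    exact_mod_cast hb
  have h9 : ∀ t : ZMod 9, t ^ 3 ≠ 6 := by decide
  exact h9 n (by exact_mod_cast congrArg (Int.cast : ℤ → ZMod 9) hn)

instance : Fact (Irreducible (X ^ 3 - C 6 : ℚ[X])) := ⟨irreducible_X_pow_three_sub_C_six⟩

/-- The number field generated by a cube root of `6`. -/
abbrev CubicField : Type := AdjoinRoot (X ^ 3 - C 6 : ℚ[X])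

namespace CubicField

theorem monic_poly : (X ^ 3 - C 6 : ℚ[X]).Monic := monic_X_pow_sub_C _ three_ne_zero

instance : FiniteDimensional ℚ CubicField := monic_poly.finite_adjoinRoot

instance : NumberField CubicField where

/-- The cube root of `6`. -/
noncomputable def ρ : CubicField := AdjoinRoot.root (X ^ 3 - C 6 : ℚ[X])

theorem ρ_pow_three : ρ ^ 3 = 6 := by
  have h := AdjoinRoot.eval₂_root (X ^ 3 - C 6 : ℚ[X])
  rw [eval₂_sub, eval₂_pow, eval₂_X, eval₂_C, sub_eq_zero] at h
  rw [ρ, h, map_ofNat]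

/-- The power basis `1, ρ, ρ ^ 2`. -/
noncomputable def basis : Module.Basis (Fin 3) ℚ CubicField :=
  (AdjoinRoot.powerBasis irreducible_X_pow_three_sub_C_six.ne_zero).basis.reindex
    (finCongr (by rw [AdjoinRoot.powerBasis_dim, natDegree_X_pow_sub_C]))

theorem basis_apply (i : Fin 3) : basis i = ρ ^ (i : ℕ) := by
  simp [basis, ρ]

theorem finrank_eq : Module.finrank ℚ CubicField = 3 := by
  simpa using Module.finrank_eq_card_basis basis

/-- The element of `CubicField` with prescribed coordinates. -/
noncomputable def ofCoords (a b c : ℚ) : CubicField :=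
  algebraMap ℚ _ a + algebraMap ℚ _ b * ρ + algebraMap ℚ _ c * ρ ^ 2

theorem ofCoords_eq_sum (a b c : ℚ) :
    ofCoords a b c = a • basis 0 + b • basis 1 + c • basis 2 := by
  simp [ofCoords, basis_apply, Algebra.smul_def]

theorem exists_eq_ofCoords (x : CubicField) : ∃ a b c, x = ofCoords a b c :=
  ⟨basis.repr x 0, basis.repr x 1, basis.repr x 2, by
    rw [ofCoords_eq_sum, ← Fin.sum_univ_three (fun i => basis.repr x i • basis i),
      basis.sum_repr]⟩

theorem repr_ofCoords (a b c : ℚ) : basis.repr (ofCoords a b c) = ![a, b, c] := by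
  rw [ofCoords_eq_sum]
  ext i
  fin_cases i <;> simp

theorem ofCoords_injective {a b c a' b' c' : ℚ} (h : ofCoords a b c = ofCoords a' b' c') :
    a = a' ∧ b = b' ∧ c = c' := by
  have h := congrArg (fun x => (basis.repr x : Fin 3 → ℚ)) h
  simp only [repr_ofCoords] at h
  exact ⟨congrFun h 0, congrFun h 1, congrFun h 2⟩

theorem ofCoords_mul (a b c a' b' c' : ℚ) :
    ofCoords a b c * ofCoords a' b' c' =
      ofCoords (a * a' + 6 * (b * c' + c * b')) (a * b' + b * a' + 6 * (c * c'))
        (a * c' + b * b' + c * a') := by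
  simp only [ofCoords, map_add, map_mul, map_ofNat]
  generalize algebraMap ℚ CubicField a = a, algebraMap ℚ CubicField b = b,
    algebraMap ℚ CubicField c = c, algebraMap ℚ CubicField a' = a',
    algebraMap ℚ CubicField b' = b', algebraMap ℚ CubicField c' = c'
  linear_combination ((b * c' + c * b') + c * c' * ρ) * ρ_pow_three

theorem leftMulMatrix_ofCoords (a b c : ℚ) :
    Algebra.leftMulMatrix basis (ofCoords a b c) = !![a, 6 * c, 6 * b; b, a, 6 * c; c, b, a] := by
  have h0 : basis 0 = ofCoords 1 0 0 := by simp [basis_apply, ofCoords]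
  have h1 : basis 1 = ofCoords 0 1 0 := by simp [basis_apply, ofCoords]
  have h2 : basis 2 = ofCoords 0 0 1 := by simp [basis_apply, ofCoords]
  ext i j
  rw [Algebra.leftMulMatrix_eq_repr_mul]
  fin_cases j <;>
    simp only [Fin.zero_eta, Fin.mk_one, Fin.reduceFinMk, h0, h1, h2, ofCoords_mul,
      repr_ofCoords] <;>
    fin_cases i <;> simp

theorem trace_ofCoords (a b c : ℚ) : Algebra.trace ℚ CubicField (ofCoords a b c) = 3 * a := by
  rw [Algebra.trace_eq_matrix_trace basis, leftMulMatrix_ofCoords, Matrix.trace_fin_three]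
  simp
  ring

theorem norm_ofCoords (a b c : ℚ) : Algebra.norm ℚ (ofCoords a b c) =
    a ^ 3 + 6 * b ^ 3 + 36 * c ^ 3 - 18 * a * b * c := by
  rw [Algebra.norm_eq_matrix_det basis, leftMulMatrix_ofCoords, Matrix.det_fin_three]
  simp
  ring

theorem nrComplexPlaces_eq : InfinitePlace.nrComplexPlaces CubicField = 1 := by
  have hpos : 0 < InfinitePlace.nrComplexPlaces CubicField := by
    refine nrComplexPlaces_pos_of_trace_sq_neg (ofCoords 0 1 (-1)) ?_
    rw [pow_two, ofCoords_mul, trace_ofCoords]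
    norm_num
  have h1 := InfinitePlace.card_add_two_mul_card_eq_rank CubicField
  rw [finrank_eq] at h1
  omega

theorem rank_eq : Units.rank CubicField = 1 := by
  have h1 := InfinitePlace.card_add_two_mul_card_eq_rank CubicField
  have h2 := InfinitePlace.card_eq_nrRealPlaces_add_nrComplexPlaces CubicField
  rw [finrank_eq] at h1
  rw [nrComplexPlaces_eq] at h1 h2
  rw [Units.rank]
  omega

theorem three_dvd_of_dvd_norm {a b c : ℤ}
    (h : 27 ∣ a ^ 3 + 6 * b ^ 3 + 36 * c ^ 3 - 18 * a * b * c) : 3 ∣ a ∧ 3 ∣ b ∧ 3 ∣ c := by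
  have h3 : Prime (3 : ℤ) := Int.prime_three
  obtain ⟨k, hk⟩ := h
  obtain ⟨a, rfl⟩ : 3 ∣ a := h3.dvd_of_dvd_pow (n := 3)
    ⟨9 * k - 2 * b ^ 3 - 12 * c ^ 3 + 6 * a * b * c, by linear_combination hk⟩
  obtain ⟨b, rfl⟩ : 3 ∣ b := h3.dvd_of_dvd_pow (n := 3)
    ⟨b ^ 3 - 3 * k + 3 * a ^ 3 + 4 * c ^ 3 - 6 * a * b * c, by linarith⟩
  obtain ⟨c, rfl⟩ : 3 ∣ c := h3.dvd_of_dvd_pow (n := 3)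
    ⟨k - a ^ 3 - 6 * b ^ 3 - c ^ 3 + 6 * a * b * c, by linarith⟩
  exact ⟨⟨a, rfl⟩, ⟨b, rfl⟩, ⟨c, rfl⟩⟩

theorem two_dvd_of_dvd_norm {a b c : ℤ}
    (h : 8 ∣ a ^ 3 + 6 * b ^ 3 + 36 * c ^ 3 - 18 * a * b * c) : 2 ∣ a ∧ 2 ∣ b ∧ 2 ∣ c := by
  have h2 : Prime (2 : ℤ) := Int.prime_two
  obtain ⟨k, hk⟩ := h
  obtain ⟨a, rfl⟩ : 2 ∣ a := h2.dvd_of_dvd_pow (n := 3)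
    ⟨4 * k - 3 * b ^ 3 - 18 * c ^ 3 + 9 * a * b * c, by linear_combination hk⟩
  obtain ⟨b, rfl⟩ : 2 ∣ b := h2.dvd_of_dvd_pow (n := 3)
    ⟨2 * k - 2 * a ^ 3 - b ^ 3 - 9 * c ^ 3 + 9 * a * b * c, by linarith⟩
  obtain ⟨c, rfl⟩ : 2 ∣ c := h2.dvd_of_dvd_pow (n := 3)
    ⟨k - a ^ 3 - 6 * b ^ 3 - 4 * c ^ 3 + 9 * a * b * c, by linarith⟩
  exact ⟨⟨a, rfl⟩, ⟨b, rfl⟩, ⟨c, rfl⟩⟩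

theorem exists_int_trace {x : CubicField} (hx : IsIntegral ℤ x) :
    ∃ n : ℤ, Algebra.trace ℚ CubicField x = n := by
  obtain ⟨n, hn⟩ := IsIntegrallyClosed.isIntegral_iff.1 (Algebra.isIntegral_trace (L := ℚ) hx)
  exact ⟨n, by rw [← hn]; rfl⟩

theorem exists_int_norm {x : CubicField} (hx : IsIntegral ℤ x) :
    ∃ n : ℤ, Algebra.norm ℚ x = n := by
  obtain ⟨n, hn⟩ := IsIntegrallyClosed.isIntegral_iff.1 (Algebra.isIntegral_norm ℚ hx)
  exact ⟨n, by rw [← hn]; rfl⟩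

theorem isIntegral_ρ : IsIntegral ℤ ρ :=
  ⟨X ^ 3 - C 6, monic_X_pow_sub_C _ three_ne_zero, by simp [eval₂_sub, ρ_pow_three]⟩

theorem exists_int_coords {x : CubicField} (hx : IsIntegral ℤ x) :
    ∃ a b c : ℤ, x = ofCoords a b c := by
  obtain ⟨a, b, c, rfl⟩ := exists_eq_ofCoords x
  have hρ1 : ρ = ofCoords 0 1 0 := by simp [ofCoords]
  have hρ2 : ρ ^ 2 = ofCoords 0 0 1 := by simp [ofCoords]
  obtain ⟨n, hn⟩ := exists_int_norm hx
  obtain ⟨A, hA⟩ := exists_int_trace hx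
  obtain ⟨C, hC⟩ := exists_int_trace (hx.mul isIntegral_ρ)
  obtain ⟨B, hB⟩ := exists_int_trace (hx.mul (isIntegral_ρ.pow 2))
  rw [norm_ofCoords] at hn
  rw [trace_ofCoords] at hA
  rw [hρ1, ofCoords_mul, trace_ofCoords] at hC
  rw [hρ2, ofCoords_mul, trace_ofCoords] at hB
  have ha : a = (6 * A : ℤ) / 18 := by push_cast; linarith
  have hb : b = B / 18 := by linarith
  have hc : c = C / 18 := by linarith
  generalize 6 * A = A at ha
  subst ha hb hc
  have hN : A ^ 3 + 6 * B ^ 3 + 36 * C ^ 3 - 18 * A * B * C = 5832 * n := by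
    have : (A : ℚ) ^ 3 + 6 * B ^ 3 + 36 * C ^ 3 - 18 * A * B * C = 5832 * n := by
      rw [← hn]; ring
    exact_mod_cast this
  obtain ⟨⟨A, rfl⟩, ⟨B, rfl⟩, ⟨C, rfl⟩⟩ := two_dvd_of_dvd_norm (a := A) (b := B) (c := C)
    ⟨729 * n, by linarith⟩
  obtain ⟨⟨A, rfl⟩, ⟨B, rfl⟩, ⟨C, rfl⟩⟩ := three_dvd_of_dvd_norm (a := A) (b := B) (c := C)
    ⟨27 * n, by linarith⟩
  obtain ⟨⟨A, rfl⟩, ⟨B, rfl⟩, ⟨C, rfl⟩⟩ := three_dvd_of_dvd_norm (a := A) (b := B) (c := C)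
    ⟨n, by linarith⟩
  refine ⟨A, B, C, ?_⟩
  congr 1 <;> push_cast <;> ring

/-- The cube root of `6` as an algebraic integer. -/
noncomputable def θ : 𝓞 CubicField := ⟨ρ, isIntegral_ρ⟩

theorem θ_pow_three : θ ^ 3 = 6 := RingOfIntegers.ext ρ_pow_three

theorem coe_int_coords (a b c : ℤ) : ((a + b * θ + c * θ ^ 2 : 𝓞 CubicField) : CubicField) =
    ofCoords a b c := by
  have h : (θ : CubicField) = ρ := rfl
  simp [ofCoords, h]

theorem exists_eq_int_coords (x : 𝓞 CubicField) : ∃ a b c : ℤ, x = a + b * θ + c * θ ^ 2 := by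
  obtain ⟨a, b, c, h⟩ := exists_int_coords (RingOfIntegers.isIntegral_coe x)
  exact ⟨a, b, c, RingOfIntegers.ext (h.trans (coe_int_coords a b c).symm)⟩

theorem int_coords_injective {a b c a' b' c' : ℤ}
    (h : (a + b * θ + c * θ ^ 2 : 𝓞 CubicField) = a' + b' * θ + c' * θ ^ 2) :
    a = a' ∧ b = b' ∧ c = c' := by
  have h := congrArg (fun x : 𝓞 CubicField => (x : CubicField)) h
  simp only [coe_int_coords] at h
  exact_mod_cast ofCoords_injective h

theorem trace_int_coords (a b c : ℤ) :
    Algebra.trace ℤ (𝓞 CubicField) (a + b * θ + c * θ ^ 2) = 3 * a := by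
  have h := Algebra.coe_trace_int (K := CubicField) (a + b * θ + c * θ ^ 2)
  rw [coe_int_coords, trace_ofCoords] at h
  exact_mod_cast h

theorem norm_int_coords (a b c : ℤ) : Algebra.norm ℤ (a + b * θ + c * θ ^ 2 : 𝓞 CubicField) =
    a ^ 3 + 6 * b ^ 3 + 36 * c ^ 3 - 18 * a * b * c := by
  have h := Algebra.coe_norm_int (K := CubicField) (a + b * θ + c * θ ^ 2)
  rw [coe_int_coords, norm_ofCoords] at h
  exact_mod_cast h

/-- The integral power basis `1, θ, θ ^ 2`. -/
noncomputable def intBasis : Module.Basis (Fin 3) ℤ (𝓞 CubicField) :=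
  Module.Basis.mk (v := ![1, θ, θ ^ 2])
    (by
      rw [Fintype.linearIndependent_iff]
      intro g hg
      have h : (g 0 + g 1 * θ + g 2 * θ ^ 2 : 𝓞 CubicField) =
          (0 : ℤ) + (0 : ℤ) * θ + (0 : ℤ) * θ ^ 2 := by
        simpa [Fin.sum_univ_three] using hg
      obtain ⟨h0, h1, h2⟩ := int_coords_injective h
      simp [Fin.forall_fin_succ, h0, h1, h2])
    (by
      intro x _
      obtain ⟨a, b, c, rfl⟩ := exists_eq_int_coords x
      have hmem (i : Fin 3) := Submodule.subset_span (R := ℤ)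
        (Set.mem_range_self (f := ![1, θ, θ ^ 2]) i)
      have h := add_mem
        (add_mem (Submodule.smul_mem _ a (hmem 0)) (Submodule.smul_mem _ b (hmem 1)))
        (Submodule.smul_mem _ c (hmem 2))
      simpa using h)

theorem discr_eq : discr CubicField = -972 := by
  have htr (x : 𝓞 CubicField) (a b c : ℤ) (hx : x = a + b * θ + c * θ ^ 2) :
      Algebra.trace ℤ (𝓞 CubicField) x = 3 * a := hx ▸ trace_int_coords a b c
  rw [← discr_eq_discr CubicField intBasis, Algebra.discr_def, Matrix.det_fin_three]
  simp only [Algebra.traceMatrix_apply, Algebra.traceForm_apply, intBasis, Module.Basis.mk_apply,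
    Matrix.cons_val, mul_one, one_mul]
  rw [htr 1 1 0 0 (by simp), htr θ 0 1 0 (by simp), htr (θ ^ 2) 0 0 1 (by simp),
    htr (θ * θ) 0 0 1 (by simp; ring), htr (θ * θ ^ 2) 6 0 0 (by
      rw [← pow_succ', θ_pow_three]; simp), htr (θ ^ 2 * θ) 6 0 0 (by
      rw [← pow_succ, θ_pow_three]; simp), htr (θ ^ 2 * θ ^ 2) 0 6 0 (by
      simp; linear_combination θ * θ_pow_three)]
  norm_num

theorem isPrincipal_of_norm_prime {P : Ideal (𝓞 CubicField)} (hP : P.IsPrime)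
    {x : 𝓞 CubicField} (hx : x ∈ P) (hn : (Algebra.norm ℤ x).natAbs.Prime) :
    Submodule.IsPrincipal P := by
  have hirr : Irreducible (Ideal.absNorm (Ideal.span {x})) := by
    rwa [Ideal.absNorm_span_singleton, Nat.irreducible_iff_prime, ← Nat.prime_iff]
  have hprime := Ideal.isPrime_of_irreducible_absNorm hirr
  have h0 : Ideal.span {x} ≠ ⊥ := by
    intro h
    rw [h, Ideal.absNorm_bot] at hirr
    exact not_irreducible_zero hirr
  have hmax := hprime.isMaximal h0
  refine ⟨x, ?_⟩
  exact (hmax.eq_of_le hP.ne_top ((Ideal.span_singleton_le_iff_mem P).2 hx)).symm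

theorem isPrincipal_of_mem {P : Ideal (𝓞 CubicField)} (hP : P.IsPrime) (a b c : ℤ)
    (hx : (a + b * θ + c * θ ^ 2 : 𝓞 CubicField) ∈ P)
    (hn : (a ^ 3 + 6 * b ^ 3 + 36 * c ^ 3 - 18 * a * b * c).natAbs.Prime) :
    Submodule.IsPrincipal P :=
  isPrincipal_of_norm_prime hP hx (by rwa [norm_int_coords])

theorem isPrincipal_of_two_mem {P : Ideal (𝓞 CubicField)} (hP : P.IsPrime) (h : 2 ∈ P) :
    Submodule.IsPrincipal P := by
  have h1 : (2 - θ) ^ 3 ∈ P := by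
    have : (2 - θ) ^ 3 = 2 * (1 - 6 * θ + 3 * θ ^ 2) := by linear_combination -θ_pow_three
    rw [this]
    exact P.mul_mem_right _ h
  refine isPrincipal_of_mem hP 2 (-1) 0 ?_ (by norm_num)
  convert hP.mem_of_pow_mem _ h1 using 1
  push_cast; ring

theorem isPrincipal_of_three_mem {P : Ideal (𝓞 CubicField)} (hP : P.IsPrime) (h : 3 ∈ P) :
    Submodule.IsPrincipal P := by
  have h1 : θ ∈ P := by
    refine hP.mem_of_pow_mem 3 ?_
    rw [θ_pow_three, show (6 : 𝓞 CubicField) = 2 * 3 by norm_num]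
    exact P.mul_mem_left _ h
  refine isPrincipal_of_mem hP 3 2 1 ?_ (by norm_num)
  convert P.add_mem h (P.mul_mem_left (2 + θ) h1) using 1
  push_cast; ring

theorem pow_sub_mem_of_absNorm_eq {P : Ideal (𝓞 CubicField)} (hP : P.IsPrime) {p : ℕ}
    (hp : p.Prime) (h : Ideal.absNorm P = p) (x : 𝓞 CubicField) : x ^ p - x ∈ P := by
  have h0 : P ≠ ⊥ := by
    rintro rfl
    rw [Ideal.absNorm_bot] at h
    exact hp.ne_zero h.symm
  have := hP.isMaximal h0
  let := Ideal.Quotient.field P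
  have : Finite (𝓞 CubicField ⧸ P) := Ideal.finiteQuotientOfFreeOfNeBot P h0
  have := Fintype.ofFinite (𝓞 CubicField ⧸ P)
  have hcard : Fintype.card (𝓞 CubicField ⧸ P) = p := by
    rw [← h, Ideal.absNorm_apply, Submodule.cardQuot_apply, Nat.card_eq_fintype_card]
  rw [← Ideal.Quotient.eq_zero_iff_mem, map_sub, map_pow, sub_eq_zero, ← hcard]
  exact FiniteField.pow_card _

theorem isPrincipal_of_five_mem {P : Ideal (𝓞 CubicField)} (hP : P.IsPrime) (h : 5 ∈ P)
    (hle : Ideal.absNorm P < 9) : Submodule.IsPrincipal P := by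
  have hnorm : Ideal.absNorm P = 5 := by
    have h1 : Ideal.absNorm P ∣ Ideal.absNorm (Ideal.span {(5 : 𝓞 CubicField)}) :=
      Ideal.absNorm_dvd_absNorm_of_le ((Ideal.span_singleton_le_iff_mem P).2 h)
    have h2 : Algebra.norm ℤ (5 : 𝓞 CubicField) = 125 := by
      simpa using norm_int_coords 5 0 0
    rw [Ideal.absNorm_span_singleton, h2, show (125 : ℤ).natAbs = 5 ^ 3 by norm_num,
      Nat.dvd_prime_pow Nat.prime_five] at h1
    obtain ⟨k, hk, hk'⟩ := h1
    have h3 : Ideal.absNorm P ≠ 1 := fun h => hP.ne_top (Ideal.absNorm_eq_one_iff.1 h)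
    interval_cases k <;> omega
  have h1 : (θ - 1) * θ ∈ P := by
    have := P.sub_mem (pow_sub_mem_of_absNorm_eq hP Nat.prime_five hnorm θ)
      (P.mul_mem_right (θ ^ 2) h)
    convert this using 1
    linear_combination -θ ^ 2 * θ_pow_three
  have hθ : θ ∉ P := by
    intro hθ
    refine hP.ne_top ((Ideal.eq_top_iff_one P).2 ?_)
    convert P.sub_mem (P.mul_mem_right (θ ^ 2) hθ) h using 1
    linear_combination -θ_pow_three
  refine isPrincipal_of_mem hP (-1) 1 0 ?_ (by norm_num)
  convert (hP.mem_or_mem h1).resolve_right hθ using 1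
  push_cast; ring

theorem isPrincipal_of_seven_mem {P : Ideal (𝓞 CubicField)} (hP : P.IsPrime) (h : 7 ∈ P) :
    Submodule.IsPrincipal P := by
  have h1 : (θ + 1) * (θ + 2) * (θ + 4) ∈ P := by
    convert P.mul_mem_right (θ ^ 2 + 2 * θ + 2) h using 1
    linear_combination θ_pow_three
  rcases hP.mem_or_mem h1 with h1 | h1
  · rcases hP.mem_or_mem h1 with h1 | h1
    · refine isPrincipal_of_mem hP 1 1 0 ?_ (by norm_num)
      convert h1 using 1
      push_cast; ring
    · refine isPrincipal_of_mem hP 7 4 2 ?_ (by norm_num)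
      convert P.add_mem h (P.mul_mem_left (2 * θ) h1) using 1
      push_cast; ring
  · refine isPrincipal_of_mem hP 13 7 4 ?_ (by norm_num)
    convert P.add_mem (P.mul_mem_right (11 + θ) h) (P.mul_mem_left (4 * (θ - 4)) h1) using 1
    push_cast; ring

theorem isPrincipal_of_absNorm_lt {P : Ideal (𝓞 CubicField)} (hP : P.IsPrime) (h0 : P ≠ ⊥)
    (hle : Ideal.absNorm P < 9) : Submodule.IsPrincipal P := by
  have hmem := Ideal.absNorm_mem P
  have h1 : Ideal.absNorm P ≠ 1 := fun h => hP.ne_top (Ideal.absNorm_eq_one_iff.1 h)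
  have h2 : Ideal.absNorm P ≠ 0 := by rwa [Ne, Ideal.absNorm_eq_zero_iff]
  obtain ⟨n, hn⟩ : ∃ n, n = Ideal.absNorm P := ⟨_, rfl⟩
  have hcases : (2 : 𝓞 CubicField) ∈ P ∨ (3 : 𝓞 CubicField) ∈ P ∨ (5 : 𝓞 CubicField) ∈ P ∨
      (7 : 𝓞 CubicField) ∈ P := by
    rw [← hn] at hmem hle h1 h2
    interval_cases n
    · exact absurd rfl h2
    · exact absurd rfl h1
    · exact Or.inl hmem
    · exact Or.inr (Or.inl hmem)
    · exact Or.inl (hP.mem_of_pow_mem 2 (by convert hmem using 1; norm_num))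
    · exact Or.inr (Or.inr (Or.inl hmem))
    · have : (2 * 3 : 𝓞 CubicField) ∈ P := by convert hmem using 1; norm_num
      rcases hP.mem_or_mem this with h | h
      · exact Or.inl h
      · exact Or.inr (Or.inl h)
    · exact Or.inr (Or.inr (Or.inr hmem))
    · exact Or.inl (hP.mem_of_pow_mem 3 (by convert hmem using 1; norm_num))
  rcases hcases with h | h | h | h
  · exact isPrincipal_of_two_mem hP h
  · exact isPrincipal_of_three_mem hP h
  · exact isPrincipal_of_five_mem hP h hle
  · exact isPrincipal_of_seven_mem hP h

instance : IsPrincipalIdealRing (𝓞 CubicField) := by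
  refine RingOfIntegers.isPrincipalIdealRing_of_isPrincipal_of_norm_le_of_isPrime
    fun I hI hle => isPrincipal_of_absNorm_lt hI (nonZeroDivisors.coe_ne_zero I) ?_
  rw [nrComplexPlaces_eq, finrank_eq, discr_eq] at hle
  have hπ := Real.pi_gt_d2
  have h1 : 4 / Real.pi < 1.274 := by
    rw [div_lt_iff₀ Real.pi_pos]
    linarith
  have h2 : √|((-972 : ℤ) : ℝ)| < 31.2 := by
    rw [Real.sqrt_lt' (by norm_num)]
    norm_num
  have h3 : (Nat.factorial 3 : ℝ) = 6 := by norm_num [Nat.factorial]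
  have h4 := Real.sqrt_nonneg |((-972 : ℤ) : ℝ)|
  rw [h3, pow_one] at hle
  have : (4 / Real.pi) * (6 / ((3 : ℕ) : ℝ) ^ 3 * √|((-972 : ℤ) : ℝ)|) < 9 := by
    have h5 : 0 < 4 / Real.pi := by positivity
    norm_num at h2 h4 ⊢
    nlinarith
  exact_mod_cast hle.trans_lt this

theorem int_coords_sq (a b c : ℤ) : (a + b * θ + c * θ ^ 2 : 𝓞 CubicField) ^ 2 =
    ((a ^ 2 + 12 * b * c : ℤ) : 𝓞 CubicField) + (2 * a * b + 6 * c ^ 2 : ℤ) * θ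
      + (b ^ 2 + 2 * a * c : ℤ) * θ ^ 2 := by
  push_cast
  linear_combination (2 * b * c + c ^ 2 * θ) * θ_pow_three

/-- The unit `1 - 6 * θ + 3 * θ ^ 2`. -/
noncomputable def ε : (𝓞 CubicField)ˣ :=
  Units.mkOfMulEqOne (1 - 6 * θ + 3 * θ ^ 2) (109 + 60 * θ + 33 * θ ^ 2)
    (by linear_combination (-18 + 99 * θ) * θ_pow_three)

theorem coe_ε : (ε : 𝓞 CubicField) = 1 - 6 * θ + 3 * θ ^ 2 := rfl

theorem coe_ε_eq : (ε : 𝓞 CubicField) = (1 : ℤ) + (-6 : ℤ) * θ + (3 : ℤ) * θ ^ 2 := by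
  rw [coe_ε]; push_cast; ring

theorem norm_ε : Algebra.norm ℤ (ε : 𝓞 CubicField) = 1 := by
  rw [coe_ε_eq, norm_int_coords]; norm_num

theorem norm_neg (x : 𝓞 CubicField) : Algebra.norm ℤ (-x) = -Algebra.norm ℤ x := by
  obtain ⟨a, b, c, rfl⟩ := exists_eq_int_coords x
  have := norm_int_coords (-a) (-b) (-c)
  rw [norm_int_coords, show -(a + b * θ + c * θ ^ 2 : 𝓞 CubicField) =
    (-a : ℤ) + (-b : ℤ) * θ + (-c : ℤ) * θ ^ 2 by push_cast; ring, norm_int_coords]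
  ring

theorem ε_ne_sq (x : 𝓞 CubicField) : (ε : 𝓞 CubicField) ≠ x ^ 2 := by
  obtain ⟨a, b, c, rfl⟩ := exists_eq_int_coords x
  rw [coe_ε_eq, int_coords_sq]
  intro h
  obtain ⟨h0, h1, h2⟩ := int_coords_injective h
  have h7 : ∀ t : ZMod 7, t ^ 2 ≠ 3 := by decide
  refine h7 (a - b + c : ℤ) ?_
  have : (a - b + c) ^ 2 = 3 + 7 * (1 - 2 * b * c + c ^ 2) := by
    linear_combination -h0 + h1 - h2
  rw [← Int.cast_pow, this]
  push_cast
  rw [show (7 : ZMod 7) = 0 from rfl]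
  ring

theorem ε_ne_neg_sq (x : 𝓞 CubicField) : (ε : 𝓞 CubicField) ≠ -x ^ 2 := by
  intro h
  have h1 := norm_ε
  rw [h, norm_neg, map_pow] at h1
  nlinarith [sq_nonneg (Algebra.norm ℤ x)]

theorem exists_fundamental_unit :
    ∃ η : (𝓞 CubicField)ˣ, ∀ u : (𝓞 CubicField)ˣ, ∃ n : ℤ, u = η ^ n ∨ u = -η ^ n := by
  have : Unique (Fin (Units.rank CubicField)) := by rw [rank_eq]; infer_instance
  refine ⟨Units.fundSystem CubicField default, fun u => ?_⟩
  obtain ⟨⟨ζ, e⟩, hu, -⟩ := Units.exist_unique_eq_mul_prod CubicField u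
  refine ⟨e default, ?_⟩
  rw [Fintype.prod_unique] at hu
  have hodd : Odd (Module.finrank ℚ CubicField) := by rw [finrank_eq]; decide
  rcases Units.torsion_eq_one_or_neg_one_of_odd_finrank hodd ζ with h | h
  · exact Or.inl (by rw [hu, h, one_mul])
  · exact Or.inr (by rw [hu, h, neg_one_mul])

/-- Every unit is, up to sign and squares, equal to `1` or `ε`. -/
theorem unit_eq (u : (𝓞 CubicField)ˣ) :
    ∃ v : (𝓞 CubicField)ˣ, u = v ^ 2 ∨ u = -v ^ 2 ∨ u = ε * v ^ 2 ∨ u = -(ε * v ^ 2) := by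
  obtain ⟨η, hη⟩ := exists_fundamental_unit
  obtain ⟨k, hk⟩ := hη ε
  obtain ⟨n, hn⟩ := hη u
  rcases Int.even_or_odd' n with ⟨m, rfl | rfl⟩
  · refine ⟨η ^ m, ?_⟩
    rw [← zpow_natCast, ← zpow_mul, Nat.cast_ofNat, mul_comm m]
    tauto
  · rcases Int.even_or_odd' k with ⟨l, rfl | rfl⟩
    · exfalso
      rw [mul_comm, zpow_mul, zpow_ofNat] at hk
      rcases hk with hk | hk
      · exact ε_ne_sq (η ^ l : (𝓞 CubicField)ˣ) (by rw [hk]; push_cast; rfl)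
      · exact ε_ne_neg_sq (η ^ l : (𝓞 CubicField)ˣ) (by rw [hk]; push_cast; rfl)
    · have h : η ^ (2 * m + 1) = η ^ (2 * l + 1) * (η ^ (m - l)) ^ 2 := by
        rw [← zpow_natCast, ← zpow_mul, ← zpow_add]
        congr 1
        push_cast; ring
      refine ⟨η ^ (m - l), ?_⟩
      rw [h] at hn
      rcases hk with hk | hk <;> rw [hk] <;> rcases hn with hn | hn <;> rw [hn] <;> simp

/-- Factorisation of `g ^ 2 = 4 * h ^ 3 - 3` in `ℤ[θ]`. -/
theorem exists_sq_or_unit_mul_sq {g h : ℤ} (hgh : g ^ 2 + 3 = 4 * h ^ 3) (hg2 : Odd g)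
    (hg3 : ¬ 3 ∣ g) : ∃ β : 𝓞 CubicField,
      2 * h - θ = (2 - θ) * β ^ 2 ∨ 2 * h - θ = (2 - θ) * (ε * β ^ 2) := by
  have hghK : (g : 𝓞 CubicField) ^ 2 + 3 = 4 * h ^ 3 := by exact_mod_cast congrArg Int.cast hgh
  set x : 𝓞 CubicField := (4 * h - 3) + (2 * h - 2) * θ + (h - 1) * θ ^ 2 with hx
  set y : 𝓞 CubicField := (4 * h ^ 2 - 3) + (2 * h - 2 * h ^ 2) * θ + (1 - h) * θ ^ 2 with hy
  have hX : 2 * h - θ = (2 - θ) * x := by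
    rw [hx]; linear_combination (h - 1) * θ_pow_three
  have hY : 4 * h ^ 2 + 2 * h * θ + θ ^ 2 = (4 + 2 * θ + θ ^ 2) * y := by
    rw [hy]
    linear_combination -((1 - h) * θ + 2 - 2 * h ^ 2) * θ_pow_three
  have hxy : x * y = g ^ 2 := by
    rw [hx, hy]
    linear_combination ((h - 1) * (1 - h) * θ + (2 * h - 2) * (1 - h) +
      (h - 1) * (2 * h - 2 * h ^ 2)) * θ_pow_three - hghK
  have hcop : IsCoprime x y := by
    have h18 : IsCoprime (18 : ℤ) (g ^ 2) := by
      have h2 : IsCoprime (2 : ℤ) g := Int.isCoprime_two_left.2 hg2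
      have h3 : IsCoprime (3 : ℤ) g := (Int.prime_three.coprime_iff_not_dvd).2 hg3
      exact ((h2.mul_left (h3.pow_left (m := 2))).pow_right : IsCoprime (2 * 3 ^ 2 : ℤ) (g ^ 2))
    obtain ⟨s, t, hst⟩ := h18
    have hstK : (s : 𝓞 CubicField) * 18 + t * g ^ 2 = 1 := by exact_mod_cast congrArg Int.cast hst
    refine ⟨t * y - s * θ * (2 - θ) * (2 * h + 2 * θ), s * θ * (4 + 2 * θ + θ ^ 2), ?_⟩
    linear_combination hstK + t * hxy + s * θ * (2 * h + 2 * θ) * hX - s * θ * hY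
      + 3 * s * θ_pow_three
  obtain ⟨d, u, hdu⟩ := exists_associated_pow_of_mul_eq_pow' hcop hxy
  have hnorm : Algebra.norm ℤ x = g ^ 2 := by
    have := norm_int_coords (4 * h - 3) (2 * h - 2) (h - 1)
    push_cast at this
    rw [hx, this]
    linear_combination -hgh
  have hg : 0 < g ^ 2 := by
    have : g ≠ 0 := by rintro rfl; exact hg3 (dvd_zero 3)
    positivity
  obtain ⟨v, hv⟩ := unit_eq u
  rw [hX]
  refine ⟨d * v, ?_⟩
  rcases hv with rfl | rfl | rfl | rfl
  · left; rw [← hdu]; push_cast; ring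
  · exfalso
    rw [← hdu] at hnorm
    push_cast at hnorm
    rw [show d ^ 2 * -(v : 𝓞 CubicField) ^ 2 = -(d * v) ^ 2 by ring, norm_neg, map_pow] at hnorm
    nlinarith [sq_nonneg (Algebra.norm ℤ (d * v))]
  · right; rw [← hdu]; push_cast; ring
  · exfalso
    rw [← hdu] at hnorm
    push_cast at hnorm
    rw [show d ^ 2 * -((ε : 𝓞 CubicField) * v ^ 2) = -(ε * (d * v) ^ 2) by ring, norm_neg,
      map_mul, norm_ε, map_pow] at hnorm
    nlinarith [sq_nonneg (Algebra.norm ℤ (d * v))]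

end CubicField

end Cubic

theorem eq_seven_of_coords {a b c h : ℤ} (h0 : a ^ 2 + 12 * b * c = 4 * h)
    (h1 : a * b + 3 * c ^ 2 = -1) (h2 : b ^ 2 + 2 * a * c = 0) : h = 7 := by
  obtain ⟨b, rfl⟩ : 2 ∣ b := Int.prime_two.dvd_of_dvd_pow (n := 2)
    ⟨-a * c, by linear_combination h2⟩
  have hcb : IsCoprime c (2 * b) := ⟨-3 * c, -a, by linear_combination -h1⟩
  have hc : IsUnit c := (hcb.pow_right (n := 2)).isUnit_of_dvd' dvd_rfl
    ⟨-2 * a, by linear_combination h2⟩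
  rcases Int.isUnit_iff.1 hc with rfl | rfl
  · have ha : a = -2 * b ^ 2 := by linarith
    subst ha
    have hb : b ^ 3 = 1 ^ 3 := by linarith
    have hb : b = 1 := (Odd.strictMono_pow (by decide : Odd 3)).injective hb
    subst hb
    linarith
  · have ha : a = 2 * b ^ 2 := by linarith
    subst ha
    have hb : b ^ 3 = (-1) ^ 3 := by linarith
    have hb : b = -1 := (Odd.strictMono_pow (by decide : Odd 3)).injective hb
    subst hb
    linarith

theorem eq_one_of_coords {a b c h : ℤ} (h0 : a ^ 2 + 12 * b * c = 4 * h - 3)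
    (h1 : a * b + 3 * c ^ 2 = h - 1) (h2 : b ^ 2 + 2 * a * c = h - 1) : h = 1 := by
  obtain ⟨d, rfl⟩ : ∃ d, b = d + 2 * c := ⟨b - 2 * c, by ring⟩
  have had : a * d = c ^ 2 + 4 * c * d + d ^ 2 := by linear_combination h1 - h2
  by_cases hd : d = 0
  · subst hd
    have hc : c = 0 := pow_eq_zero_iff two_ne_zero |>.1 (by linear_combination -had)
    subst hc
    linarith
  exfalso
  obtain ⟨g, p, q, hg, hpq, rfl, rfl⟩ : ∃ g p q : ℤ,
      g ≠ 0 ∧ IsCoprime p q ∧ d = g * p ∧ c = g * q := by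
    have hne : Int.gcd d c ≠ 0 := fun h => hd (Int.gcd_eq_zero_iff.1 h).1
    obtain ⟨p, q, hpq, hp, hq⟩ := Int.exists_gcd_one (Nat.pos_of_ne_zero hne)
    exact ⟨Int.gcd d c, p, q, by exact_mod_cast hne, Int.isCoprime_iff_gcd_eq_one.2 hpq,
      hp.trans (mul_comm _ _), hq.trans (mul_comm _ _)⟩
  have hap : a * p = g * (q ^ 2 + 4 * q * p + p ^ 2) :=
    mul_left_cancel₀ hg (by linear_combination had)
  have hpg : p ∣ g := by
    have hcop : IsCoprime p (q ^ 2 + 4 * q * p + p ^ 2) := by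
      have h := (hpq.pow_right (n := 2)).add_mul_left_right (4 * q + p)
      rwa [show q ^ 2 + p * (4 * q + p) = q ^ 2 + 4 * q * p + p ^ 2 by ring] at h
    exact hcop.dvd_of_dvd_mul_right ⟨a, by linear_combination -hap⟩
  obtain ⟨k, rfl⟩ := hpg
  have hp : p ≠ 0 := left_ne_zero_of_mul hg
  have ha : a = k * (q ^ 2 + 4 * q * p + p ^ 2) := mul_left_cancel₀ hp (by linear_combination hap)
  subst ha
  have hk : k ^ 2 * (q ^ 4 - 6 * p ^ 2 * q ^ 2 - 4 * p ^ 3 * q - 3 * p ^ 4) = 1 := by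
    linear_combination h0 - 4 * h2
  have hk2 : k ^ 2 = 1 := by
    have := Int.eq_one_or_neg_one_of_mul_eq_one hk
    have := sq_nonneg k
    omega
  rw [hk2, one_mul] at hk
  exact hp (eq_zero_of_quartic_eq_one hk)

open NumberField CubicField in
theorem eq_one_or_eq_seven {g h : ℤ} (hgh : g ^ 2 + 3 = 4 * h ^ 3) (hg2 : Odd g)
    (hg3 : ¬ 3 ∣ g) : h = 1 ∨ h = 7 := by
  obtain ⟨β, hβ | hβ⟩ := exists_sq_or_unit_mul_sq hgh hg2 hg3
  · left
    obtain ⟨a, b, c, rfl⟩ := exists_eq_int_coords β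
    have h2 : (2 * ((4 * h - 3 : ℤ) + (2 * h - 2 : ℤ) * θ + (h - 1 : ℤ) * θ ^ 2) : 𝓞 CubicField)
        = 2 * (a + b * θ + c * θ ^ 2) ^ 2 := by
      push_cast
      generalize (a + b * θ + c * θ ^ 2 : 𝓞 CubicField) ^ 2 = z at *
      linear_combination (4 + 2 * θ + θ ^ 2) * hβ + (1 - z) * θ_pow_three
    rw [mul_right_inj' two_ne_zero, int_coords_sq] at h2
    obtain ⟨e0, e1, e2⟩ := int_coords_injective h2
    exact eq_one_of_coords (a := a) (b := b) (c := c) (by linarith) (by linarith) (by linarith)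
  · right
    obtain ⟨a, b, c, hγ⟩ := exists_eq_int_coords ((2 - θ) ^ 2 * β)
    have h2 : ((4 * h : ℤ) + (-2 : ℤ) * θ + (0 : ℤ) * θ ^ 2 : 𝓞 CubicField)
        = (a + b * θ + c * θ ^ 2) ^ 2 := by
      rw [← hγ]
      rw [coe_ε] at hβ
      push_cast
      linear_combination 2 * hβ + (2 - θ) * β ^ 2 * θ_pow_three
    rw [int_coords_sq] at h2
    obtain ⟨e0, e1, e2⟩ := int_coords_injective h2
    exact eq_seven_of_coords (a := a) (b := b) (c := c) (by linarith) (by linarith) (by linarith)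

theorem quadratic_form_of_cubic_eq_one {m n : ℤ}
    (hF : (m ^ 3 - 3 * m * n ^ 2 - n ^ 3).natAbs = 1) :
    m ^ 2 + m * n + n ^ 2 = 1 ∨ m ^ 2 + m * n + n ^ 2 = 7 := by
  have hF2 : (m ^ 3 - 3 * m * n ^ 2 - n ^ 3) ^ 2 = 1 := by
    rw [← Int.natAbs_sq, hF]; norm_num
  have hgh : (m ^ 3 + 6 * m ^ 2 * n + 3 * m * n ^ 2 - n ^ 3) ^ 2 + 3 =
      4 * (m ^ 2 + m * n + n ^ 2) ^ 3 := by linear_combination -3 * hF2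
  refine eq_one_or_eq_seven hgh ?_ ?_
  · refine Int.not_even_iff_odd.1 fun ⟨k, hk⟩ => ?_
    rw [hk, show (k + k) ^ 2 = 4 * k ^ 2 by ring] at hgh
    omega
  · rintro ⟨k, hk⟩
    have h9 : 9 * (k - 2 * m ^ 2 * n - 2 * m * n ^ 2) ^ 2 = 1 := by
      rw [← hF2, show m ^ 3 - 3 * m * n ^ 2 - n ^ 3 =
        3 * (k - 2 * m ^ 2 * n - 2 * m * n ^ 2) by linear_combination hk]
      ring
    omega

/-- f(x) is an integer if and only if x ∈ {1, -1, -2, 0, -1/2, 2, -3/2, -1/3}. -/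
theorem f_integral_iff (x : ℚ) :
    (∃ k : ℤ, f x = (k : ℚ)) ↔
      x = 1 ∨ x = -1 ∨ x = -2 ∨ x = 0 ∨ x = -1/2 ∨ x = 2 ∨ x = -3/2 ∨ x = -1/3 := by
  constructor
  · rintro ⟨k, hk⟩
    have hn : (0 : ℤ) < x.den := by exact_mod_cast x.den_pos
    have hx : x = (x.num : ℚ) / ((x.den : ℤ) : ℚ) := by exact_mod_cast x.num_div_den.symm
    have hmn : IsCoprime x.num (x.den : ℤ) := Rat.isCoprime_num_den x
    rw [hx] at hk
    have := eq_of_quadratic_form hn (m := x.num) ?_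
    · rwa [← hx] at this
    · rcases cubic_of_f_integral hmn hn.ne' hk with h | h
      · exact Or.inr ⟨quadratic_form_of_cubic_eq_one h, h⟩
      · exact Or.inl ⟨quadratic_form_of_cubic_eq_three h, h⟩
  · rintro (rfl | rfl | rfl | rfl | rfl | rfl | rfl | rfl)
    · exact ⟨0, by norm_num [f]⟩
    · exact ⟨0, by norm_num [f]⟩
    · exact ⟨419904, by norm_num [f]⟩
    · exact ⟨-44789760, by norm_num [f]⟩
    · exact ⟨15786448344, by norm_num [f]⟩
    · exact ⟨24992518538304, by norm_num [f]⟩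
    · exact ⟨-92515041526500, by norm_num [f]⟩
    · exact ⟨-70043919611288518656, by norm_num [f]⟩
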